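/- arXiv:0706.3028 — 3 statements merged into one kernel-verified Lean document; each statement's English description precedes it below -/
import Mathlib

section
/- Let R be a complete regular local ring of prime characteristic p > 0, let g ∈ R, let a ≥ 0 and β ≥ 1 be integers, and for s ≥ 1 set ψ_s(p^β) = 1 + p^β + ⋯ + p^{β(s−1)} = (p^{βs} − 1)/(p^β − 1). Then the ideals I_{sβ}(g^{a·ψ_s(p^β)}) form a descending chain in s, i.e. I_{(s+1)β}(g^{a·ψ_{s+1}(p^β)}) ⊆ I_{sβ}(g^{a·ψ_s(p^β)}) for all s ≥ 1, and this chain stabilizes: there exists s₀ ≥ 1 such that I_{sβ}(g^{a·ψ_s(p^β)}) = I_{s₀β}(g^{a·ψ_{s₀}(p^β)}) for all s ≥ s₀. -/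
/-- The `q`-th bracket power of an ideal: the ideal generated by the `q`-th powers
of the elements of `J`. -/
def bracketPow {R : Type*} [CommRing R] (J : Ideal R) (q : ℕ) : Ideal R :=
  Ideal.span ((fun x => x ^ q) '' (J : Set R))

/-- `Ie p a e` is the intersection of all ideals `I` with `a ⊆ I^{[p^e]}`. -/
def Ie {R : Type*} [CommRing R] (p : ℕ) (a : Ideal R) (e : ℕ) : Ideal R :=
  sInf {I : Ideal R | a ≤ bracketPow I (p ^ e)}

/-- Condition (*): `a ⊆ I_e(a)^{[p^e]}` for every ideal `a` and every `e ≥ 1`. -/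
def CondStar (R : Type*) [CommRing R] (p : ℕ) : Prop :=
  ∀ (a : Ideal R) (e : ℕ), 1 ≤ e → a ≤ bracketPow (Ie p a e) (p ^ e)

/-- The generalized test ideal `τ(a^c)`: the supremum, in the lattice of ideals of `R`,
of the ideals `I_e(a^{⌈c p^e⌉})` for `e ≥ 1`. -/
noncomputable def tau {R : Type*} [CommRing R] (p : ℕ) (a : Ideal R) (c : ℝ) : Ideal R :=
  ⨆ e : {e : ℕ // 1 ≤ e}, Ie p (a ^ ⌈c * (p : ℝ) ^ (e : ℕ)⌉₊) (e : ℕ)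

/-- `c > 0` is an F-jumping coefficient of `a` if `τ(a^c) ≠ τ(a^{c-ε})` for all
`0 < ε < c`. -/
def IsFJumpingCoeff {R : Type*} [CommRing R] (p : ℕ) (a : Ideal R) (c : ℝ) : Prop :=
  0 < c ∧ ∀ ε : ℝ, 0 < ε → ε < c → tau p a c ≠ tau p a (c - ε)

/-- `x` is an accumulation point of `S ⊆ ℝ`. -/
def IsAccumulationPt (S : Set ℝ) (x : ℝ) : Prop :=
  ∀ ε : ℝ, 0 < ε → ∃ y ∈ S, y ≠ x ∧ |y - x| < ε

/-- `R` is a regular local ring: Noetherian, local, and the maximal ideal is generated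
by `dim R` elements. -/
def IsRegularStmt (R : Type*) [CommRing R] [IsLocalRing R] : Prop :=
  ∃ s : Finset R, IsLocalRing.maximalIdeal R = Ideal.span (s : Set R) ∧
    (s.card : WithBot (WithTop ℕ)) = ringKrullDim R

/-- `ψ_s(p^β) = 1 + p^β + ⋯ + p^{β(s-1)}`. -/
def psi (p β s : ℕ) : ℕ := ∑ i ∈ Finset.range s, p ^ (β * i)

universe u

open IsLocalRing


/-- length of `R / I` -/
noncomputable def lam {R : Type*} [CommRing R] (I : Ideal R) : ℕ∞ := Module.length R (R ⧸ I)

lemma lam_anti {R : Type*} [CommRing R] {I J : Ideal R} (h : I ≤ J) : lam J ≤ lam I :=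
  Module.length_le_of_surjective (Submodule.factor h) (Submodule.factor_surjective h)

lemma lam_top {R : Type*} [CommRing R] : lam (⊤ : Ideal R) = 0 := by
  rw [lam, Module.length_eq_zero_iff]
  exact Ideal.Quotient.subsingleton_iff.mpr rfl

/-- colon ideal -/
def cln {R : Type*} [CommRing R] (I : Ideal R) (c : R) : Ideal R where
  carrier := {r | c * r ∈ I}
  add_mem' := by
    intro a b ha hb
    simp only [Set.mem_ofPred_eq, mul_add] at *
    exact I.add_mem ha hb
  zero_mem' := by simp
  smul_mem' := by
    intro a b hb
    simp only [Set.mem_ofPred_eq, smul_eq_mul] at *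
    rw [mul_left_comm]
    exact I.mul_mem_left _ hb

lemma mem_cln {R : Type*} [CommRing R] {I : Ideal R} {c r : R} : r ∈ cln I c ↔ c * r ∈ I := Iff.rfl

lemma lam_cln {R : Type*} [CommRing R] (I : Ideal R) (c : R) :
    lam I = lam (I ⊔ Ideal.span {c}) + lam (cln I c) := by
  have hle : cln I c ≤ Submodule.comap (LinearMap.lsmul R R c) I := fun r hr => hr
  let f : (R ⧸ cln I c) →ₗ[R] (R ⧸ I) := Submodule.mapQ _ _ (LinearMap.lsmul R R c) hle
  let g : (R ⧸ I) →ₗ[R] (R ⧸ (I ⊔ Ideal.span {c})) := Submodule.factor le_sup_left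
  rw [add_comm]
  refine Module.length_eq_add_of_exact f g ?_ (Submodule.factor_surjective _) ?_
  · rw [← LinearMap.ker_eq_bot, LinearMap.ker_eq_bot']
    intro x hx
    obtain ⟨r, rfl⟩ := Submodule.Quotient.mk_surjective _ x
    simp only [f, Submodule.mapQ_apply, Submodule.Quotient.mk_eq_zero] at hx ⊢
    exact hx
  · intro y
    obtain ⟨r, rfl⟩ := Submodule.Quotient.mk_surjective _ y
    have : g (Submodule.Quotient.mk r) = Submodule.Quotient.mk r := rfl
    rw [this, Submodule.Quotient.mk_eq_zero]
    constructor
    · intro h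
      obtain ⟨i, hi, z, hz, rfl⟩ := Submodule.mem_sup.mp h
      obtain ⟨w, rfl⟩ := Ideal.mem_span_singleton'.mp hz
      refine ⟨Submodule.Quotient.mk w, ?_⟩
      simp only [f, Submodule.mapQ_apply]
      rw [Submodule.Quotient.eq]
      have : (LinearMap.lsmul R R c) w - (i + w * c) = -i := by simp; ring
      rw [this]; exact I.neg_mem hi
    · rintro ⟨x, hx⟩
      obtain ⟨w, rfl⟩ := Submodule.Quotient.mk_surjective _ x
      simp only [f, Submodule.mapQ_apply] at hx
      rw [Submodule.Quotient.eq] at hx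
      have h2 : r = -(c * w - r) + w * c := by ring
      rw [h2]
      exact Submodule.add_mem_sup (I.neg_mem hx) (Ideal.mem_span_singleton'.mpr ⟨w, rfl⟩)

lemma lam_inf_sup {R : Type*} [CommRing R] (I J : Ideal R) :
    lam I + lam J = lam (I ⊓ J) + lam (I ⊔ J) := by
  let f : (R ⧸ (I ⊓ J)) →ₗ[R] (R ⧸ I) × (R ⧸ J) :=
    (Submodule.factor inf_le_left).prod (Submodule.factor inf_le_right)
  let g : (R ⧸ I) × (R ⧸ J) →ₗ[R] (R ⧸ (I ⊔ J)) :=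
    (Submodule.factor le_sup_left).coprod (-(Submodule.factor le_sup_right))
  have := Module.length_eq_add_of_exact f g ?_ ?_ ?_
  · rw [Module.length_prod] at this; exact this
  · rw [← LinearMap.ker_eq_bot, LinearMap.ker_eq_bot']
    intro x hx
    obtain ⟨r, rfl⟩ := Submodule.Quotient.mk_surjective _ x
    have h1 : (Submodule.Quotient.mk r : R ⧸ I) = 0 := congrArg Prod.fst hx
    have h2 : (Submodule.Quotient.mk r : R ⧸ J) = 0 := congrArg Prod.snd hx
    rw [Submodule.Quotient.mk_eq_zero] at *
    exact ⟨h1, h2⟩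
  · intro x
    obtain ⟨r, rfl⟩ := Submodule.Quotient.mk_surjective _ x
    exact ⟨(Submodule.Quotient.mk r, 0), by simp [g]⟩
  · rintro ⟨x, y⟩
    obtain ⟨r, rfl⟩ := Submodule.Quotient.mk_surjective _ x
    obtain ⟨s, rfl⟩ := Submodule.Quotient.mk_surjective _ y
    have : g (Submodule.Quotient.mk r, Submodule.Quotient.mk s) = Submodule.Quotient.mk (r - s) := by
      simp [g, sub_eq_add_neg]
    rw [this, Submodule.Quotient.mk_eq_zero]
    constructor
    · intro h
      obtain ⟨i, hi, j, hj, hij⟩ := Submodule.mem_sup.mp h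
      refine ⟨Submodule.Quotient.mk (r - i), ?_⟩
      refine Prod.ext ?_ ?_
      · change (Submodule.Quotient.mk (r - i) : R ⧸ I) = Submodule.Quotient.mk r
        rw [Submodule.Quotient.eq]; simpa using hi
      · change (Submodule.Quotient.mk (r - i) : R ⧸ J) = Submodule.Quotient.mk s
        rw [Submodule.Quotient.eq]
        have : r - i - s = j := by linear_combination -hij
        rwa [this]
    · rintro ⟨x, hx⟩
      obtain ⟨w, rfl⟩ := Submodule.Quotient.mk_surjective _ x
      have h1 : (Submodule.Quotient.mk w : R ⧸ I) = Submodule.Quotient.mk r := congrArg Prod.fst hx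
      have h2 : (Submodule.Quotient.mk w : R ⧸ J) = Submodule.Quotient.mk s := congrArg Prod.snd hx
      rw [Submodule.Quotient.eq] at h1 h2
      have : r - s = -(w - r) + (w - s) := by ring
      rw [this]
      exact Submodule.add_mem_sup (I.neg_mem h1) h2

lemma lam_eq_zero {R : Type*} [CommRing R] {I : Ideal R} : lam I = 0 ↔ I = ⊤ := by
  rw [lam, Module.length_eq_zero_iff]
  exact Ideal.Quotient.subsingleton_iff

/-- equality from equal finite length -/
lemma eq_of_lam {R : Type*} [CommRing R] {I J : Ideal R} (h : I ≤ J) (hf : lam I ≠ ⊤)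
    (he : lam I ≤ lam J) : I = J := by
  refine le_antisymm h fun c hc => ?_
  have h1 := lam_cln I c
  have h2 : lam J ≤ lam (I ⊔ Ideal.span {c}) :=
    lam_anti (sup_le h ((Ideal.span_singleton_le_iff_mem _).mpr hc))
  have h3 : lam (cln I c) = 0 := by
    have h4 : lam (I ⊔ Ideal.span {c}) ≠ ⊤ := fun h => hf (by rw [h1, h, top_add])
    have h5 : lam (I ⊔ Ideal.span {c}) + lam (cln I c) ≤ lam (I ⊔ Ideal.span {c}) + 0 := by
      rw [← h1, add_zero]; exact he.trans h2
    exact nonpos_iff_eq_zero.mp ((ENat.add_le_add_iff_left h4).mp h5)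
  rw [lam_eq_zero, Ideal.eq_top_iff_one, mem_cln, mul_one] at h3
  exact h3

lemma lam_max {R : Type*} [CommRing R] [IsLocalRing R] : lam (maximalIdeal R) = 1 := by
  rw [lam, Module.length_eq_one_iff]
  exact isSimpleModule_iff_isCoatom.mpr (maximalIdeal.isMaximal R).out

/-- socle element between two ideals -/
lemma exists_socle {R : Type*} [CommRing R] [IsLocalRing R] {I J : Ideal R} (h : I < J) {t : ℕ}
    (ht : maximalIdeal R ^ t ≤ I) : ∃ u ∈ J, u ∉ I ∧ cln I u = maximalIdeal R := by
  classical
  have hex : ∃ k, maximalIdeal R ^ k * J ≤ I := ⟨t, Ideal.mul_le_left.trans ht⟩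
  have hk := Nat.find_spec hex
  have hk0 : Nat.find hex ≠ 0 := by
    intro h0
    rw [h0] at hk
    simp at hk
    exact absurd h (not_lt_of_ge hk)
  obtain ⟨k, hk'⟩ := Nat.exists_eq_succ_of_ne_zero hk0
  have hm := Nat.find_min hex (m := k) (by omega)
  rw [hk'] at hk
  obtain ⟨u, hu, huI⟩ := SetLike.not_le_iff_exists.mp hm
  refine ⟨u, Ideal.mul_le_right hu, huI, ?_⟩
  symm
  refine (maximalIdeal.isMaximal R).eq_of_le ?_ ?_
  · rw [Ne, Ideal.eq_top_iff_one, mem_cln, mul_one]; exact huI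
  · intro r hr
    rw [mem_cln, mul_comm]
    apply hk
    rw [Nat.succ_eq_add_one, pow_succ', mul_assoc]
    exact Ideal.mul_mem_mul hr hu

/-- Noetherian induction upward through socle steps. -/
lemma socle_induction {R : Type*} [CommRing R] [IsNoetherianRing R] [IsLocalRing R]
    {P : Ideal R → Prop} (htop : P ⊤)
    (hstep : ∀ I u, u ∉ I → cln I u = maximalIdeal R → P (I ⊔ Ideal.span {u}) → P I)
    (I : Ideal R) {t : ℕ} (ht : maximalIdeal R ^ t ≤ I) : P I := by
  induction I using WellFoundedGT.induction with
  | ind I ih =>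
    by_cases hI : I = ⊤
    · rwa [hI]
    · obtain ⟨u, -, hu, hc⟩ := exists_socle (lt_top_iff_ne_top.mpr hI) ht
      refine hstep I u hu hc (ih _ ?_ (ht.trans le_sup_left))
      refine lt_of_le_of_ne le_sup_left fun h => hu ?_
      rw [h]
      exact Ideal.mem_sup_right (Ideal.mem_span_singleton_self u)

lemma lam_ne_top {R : Type*} [CommRing R] [IsNoetherianRing R] [IsLocalRing R]
    (I : Ideal R) {t : ℕ} (ht : maximalIdeal R ^ t ≤ I) : lam I ≠ ⊤ := by
  refine socle_induction (P := fun I => lam I ≠ ⊤) (by simp [lam_top]) ?_ I ht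
  intro I u hu hc h
  rw [lam_cln I u, hc, lam_max]
  simpa using h

/-- powers of an element regular modulo `J` -/
lemma lam_pow {R : Type*} [CommRing R] (J : Ideal R) (x : R) (hx : ∀ r, x * r ∈ J → r ∈ J) (a : ℕ) :
    lam (J ⊔ Ideal.span {x ^ a}) = a * lam (J ⊔ Ideal.span {x}) := by
  induction a with
  | zero => simp [lam_top]
  | succ a ih =>
    rw [lam_cln (J ⊔ Ideal.span {x ^ (a + 1)}) x]
    have h1 : J ⊔ Ideal.span {x ^ (a + 1)} ⊔ Ideal.span {x} = J ⊔ Ideal.span {x} := by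
      rw [sup_assoc]; congr 1
      rw [sup_eq_right, Ideal.span_singleton_le_span_singleton]
      exact dvd_pow_self x (by omega)
    have h2 : cln (J ⊔ Ideal.span {x ^ (a + 1)}) x = J ⊔ Ideal.span {x ^ a} := by
      apply le_antisymm
      · intro r hr
        rw [mem_cln] at hr
        obtain ⟨j, hj, z, hz, h⟩ := Submodule.mem_sup.mp hr
        obtain ⟨w, rfl⟩ := Ideal.mem_span_singleton'.mp hz
        have h3 : r - w * x ^ a ∈ J := hx _ (by
          have : x * (r - w * x ^ a) = j := by rw [mul_sub, ← h]; ring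
          rwa [this])
        have : r = (r - w * x ^ a) + w * x ^ a := by ring
        rw [this]
        exact Submodule.add_mem_sup h3 (Ideal.mem_span_singleton'.mpr ⟨w, rfl⟩)
      · refine sup_le (fun r hr => Ideal.mem_sup_left (J.mul_mem_left _ hr)) ?_
        rw [Ideal.span_singleton_le_iff_mem, mem_cln, ← pow_succ']
        exact Ideal.mem_sup_right (Ideal.mem_span_singleton_self _)
    rw [h1, h2, ih]
    push_cast
    ring


lemma list_exchange {R : Type*} [CommRing R] [IsLocalRing R] (l : List R) (x : R)
    (hx : x ∈ Ideal.ofList l) : x ∈ maximalIdeal R * Ideal.ofList l ∨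
      ∃ l1 y l2, l = l1 ++ y :: l2 ∧ y ∈ Ideal.span {x} ⊔ Ideal.ofList (l1 ++ l2) := by
  induction l generalizing x with
  | nil =>
    left
    simpa using hx
  | cons y l ih =>
    rw [Ideal.ofList_cons] at hx
    obtain ⟨a, ha, z, hz, rfl⟩ := Submodule.mem_sup.mp hx
    obtain ⟨c, rfl⟩ := Ideal.mem_span_singleton'.mp ha
    by_cases hc : IsUnit c
    · right
      refine ⟨[], y, l, rfl, ?_⟩
      obtain ⟨d, hd⟩ := hc.exists_left_inv
      have h1 : d * (c * y + z) + -(d * z) ∈ Ideal.span {c * y + z} ⊔ Ideal.ofList l :=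
        Submodule.add_mem_sup (Ideal.mem_span_singleton'.mpr ⟨d, rfl⟩)
          (neg_mem (Ideal.mul_mem_left _ _ hz))
      have h2 : d * (c * y + z) + -(d * z) = y := by linear_combination y * hd
      rw [h2] at h1
      exact h1
    · have hcm : c ∈ maximalIdeal R := hc
      rcases ih z hz with h | ⟨l1, w, l2, rfl, hw⟩
      · left
        refine Ideal.add_mem _ (Ideal.mul_mem_mul hcm ?_) (Ideal.mul_mono_right ?_ h)
        · exact Ideal.subset_span (by simp)
        · rw [Ideal.ofList_cons]; exact le_sup_right
      · right
        refine ⟨y :: l1, w, l2, rfl, ?_⟩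
        obtain ⟨u, hu, v, hv, rfl⟩ := Submodule.mem_sup.mp hw
        obtain ⟨d, rfl⟩ := Ideal.mem_span_singleton'.mp hu
        rw [List.cons_append, Ideal.ofList_cons, sup_left_comm, ← sup_assoc]
        refine Ideal.add_mem _ ?_ (Ideal.mem_sup_right hv)
        have : d * z = -(d * c) * y + d * (c * y + z) := by ring
        rw [this]
        exact Ideal.mem_sup_left (Submodule.add_mem_sup
          (Ideal.mem_span_singleton'.mpr ⟨_, rfl⟩) (Ideal.mem_span_singleton'.mpr ⟨_, rfl⟩))

/-- `l` is a system generating the maximal ideal, of length at most the dimension. -/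
def Rg (R : Type*) [CommRing R] [IsLocalRing R] (l : List R) : Prop :=
  maximalIdeal R = Ideal.ofList l ∧ (l.length : WithBot ℕ∞) ≤ ringKrullDim R

lemma dim_le_length {R : Type*} [CommRing R] [IsNoetherianRing R] [IsLocalRing R] (l : List R)
    (h : maximalIdeal R = Ideal.ofList l) : ringKrullDim R ≤ (l.length : WithBot ℕ∞) := by
  classical
  refine (ringKrullDim_le_spanFinrank_maximalIdeal R).trans ?_
  have h1 : (maximalIdeal R).spanFinrank ≤ l.length := by
    have h2 : maximalIdeal R = Submodule.span R (l.toFinset : Set R) := by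
      rw [h]; unfold Ideal.ofList Ideal.span; congr 1; ext; simp
    rw [h2]
    refine (Submodule.spanFinrank_span_le_ncard_of_finite (Finset.finite_toSet _)).trans ?_
    rw [Set.ncard_coe_finset]
    exact List.toFinset_card_le l
  exact_mod_cast h1

lemma isLocalRing_quot {R : Type*} [CommRing R] [IsLocalRing R] {x : R}
    (hx : x ∈ maximalIdeal R) : IsLocalRing (R ⧸ Ideal.span {x}) := by
  have : Nontrivial (R ⧸ Ideal.span {x}) := by
    rw [Ideal.Quotient.nontrivial_iff]
    intro h
    rw [Ideal.span_singleton_eq_top] at h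
    exact hx h
  exact IsLocalRing.of_surjective' (Ideal.Quotient.mk _) Ideal.Quotient.mk_surjective

lemma Rg_quot {R : Type*} [CommRing R] [IsNoetherianRing R] [IsLocalRing R] (x : R) (l : List R)
    (h : Rg R (x :: l)) [IsLocalRing (R ⧸ Ideal.span {x})] :
    Rg (R ⧸ Ideal.span {x}) (l.map (Ideal.Quotient.mk (Ideal.span {x}))) := by
  have hx : x ∈ maximalIdeal R := by rw [h.1]; exact Ideal.subset_span (by simp)
  constructor
  · rw [← Ideal.map_ofList]
    have h1 : maximalIdeal (R ⧸ Ideal.span {x}) =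
        (maximalIdeal R).map (Ideal.Quotient.mk (Ideal.span {x})) := by
      symm
      rcases Ideal.map_eq_top_or_isMaximal_of_surjective (Ideal.Quotient.mk (Ideal.span {x}))
        Ideal.Quotient.mk_surjective (maximalIdeal.isMaximal R) with h | h
      · exfalso
        have h2 := congrArg (Ideal.comap (Ideal.Quotient.mk (Ideal.span {x}))) h
        rw [Ideal.comap_map_of_surjective _ Ideal.Quotient.mk_surjective, Ideal.comap_top,
          ← RingHom.ker_eq_comap_bot, Ideal.mk_ker, sup_eq_left.mpr] at h2
        · exact (maximalIdeal.isMaximal R).ne_top h2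
        · exact (Ideal.span_singleton_le_iff_mem _).mpr hx
      · exact eq_maximalIdeal h
    rw [h1, h.1, Ideal.ofList_cons, Ideal.map_sup, sup_eq_right, Ideal.map_span]
    simp
  · have h1 := ringKrullDim_le_ringKrullDim_quotient_add_card ({x} : Finset R) (by
      rw [IsLocalRing.ringJacobson_eq_maximalIdeal]; simpa using hx)
    rw [Finset.coe_singleton] at h1
    have h2 := h.2.trans h1
    rw [List.length_map]
    simp only [List.length_cons, Finset.card_singleton, Nat.cast_add, Nat.cast_one] at h2
    revert h2
    generalize ringKrullDim (R ⧸ Ideal.span {x}) = d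
    intro h2
    induction d with
    | bot =>
      rw [WithBot.bot_add, le_bot_iff] at h2
      exact absurd h2 (by exact_mod_cast WithBot.coe_ne_bot)
    | coe d =>
      have h3 : ((l.length : ℕ∞) + 1) ≤ d + 1 := by exact_mod_cast h2
      have h4 := (ENat.add_le_add_iff_right ENat.one_ne_top).mp h3
      exact_mod_cast h4

lemma Rg_domain (n : ℕ) : ∀ (R : Type u) [CommRing R] [IsNoetherianRing R] [IsLocalRing R]
    (l : List R), l.length = n → Rg R l → IsDomain R := by
  induction n with
  | zero =>
    intro R _ _ _ l hl h
    have h1 := h.1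
    rw [List.length_eq_zero_iff.mp hl, Ideal.ofList_nil] at h1
    exact (IsLocalRing.isField_iff_maximalIdeal_eq.mpr h1).isDomain
  | succ n ih =>
    intro R _ _ _ l hl h
    have hdim : (1 : WithBot ℕ∞) ≤ ringKrullDim R := by
      refine le_trans ?_ h.2
      rw [hl]; exact_mod_cast Nat.le_add_left 1 n
    have hh : ¬ (maximalIdeal R).height = 0 := by
      intro h0
      rw [← IsLocalRing.maximalIdeal_height_eq_ringKrullDim, h0] at hdim
      exact absurd hdim (by decide)
    obtain ⟨x, hxm, hx2, hxP⟩ : ∃ x ∈ maximalIdeal R, x ∉ maximalIdeal R ^ 2 ∧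
        ∀ P ∈ minimalPrimes R, x ∉ P := by
      by_contra hcon
      push Not at hcon
      have hfin : (insert (maximalIdeal R ^ 2) (minimalPrimes R)).Finite :=
        (minimalPrimes.finite_of_isNoetherianRing R).insert _
      have := (Ideal.subset_union_prime_finite (R := R) hfin (f := id)
        (maximalIdeal R ^ 2) (maximalIdeal R ^ 2) (I := maximalIdeal R) ?_).mp ?_
      · obtain ⟨J, hJ, hle⟩ := this
        rcases hJ with rfl | hJ
        · apply hh
          have hbot : maximalIdeal R = ⊥ := by
            refine Submodule.eq_bot_of_le_smul_of_le_jacobson_bot (maximalIdeal R) _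
              (IsNoetherian.noetherian _) ?_ (IsLocalRing.maximalIdeal_le_jacobson _)
            rw [smul_eq_mul, ← pow_two]; exact hle
          have := IsLocalRing.isField_iff_maximalIdeal_eq.mpr hbot
          have := this.isDomain
          rw [hbot]; exact Ideal.height_bot
        · apply hh
          have hp : J.IsPrime := hJ.1.1
          have : J = maximalIdeal R :=
            le_antisymm (IsLocalRing.le_maximalIdeal hp.ne_top) hle
          rw [← this]
          exact Ideal.height_eq_zero_iff.mpr hJ
      · rintro i (rfl | hi) h1 -
        · exact absurd rfl h1
        · exact hi.1.1
      · intro x hx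
        by_cases hx2 : x ∈ maximalIdeal R ^ 2
        · exact Set.mem_biUnion (Set.mem_insert _ _) hx2
        · obtain ⟨P, hP, hxP⟩ := hcon x hx hx2
          exact Set.mem_biUnion (Set.mem_insert_of_mem _ hP) hxP
    have hxl : x ∈ Ideal.ofList l := by rw [← h.1]; exact hxm
    rcases list_exchange l x hxl with h1 | ⟨l1, y, l2, rfl, hy⟩
    · rw [← h.1, ← pow_two] at h1
      exact absurd h1 hx2
    have hRg : Rg R (x :: (l1 ++ l2)) := by
      constructor
      · apply le_antisymm
        · rw [h.1]
          refine Ideal.span_le.mpr fun z hz => ?_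
          simp only [Set.mem_ofPred_eq, List.mem_append, List.mem_cons] at hz
          rw [SetLike.mem_coe]
          by_cases hzy : z = y
          · rw [hzy, Ideal.ofList_cons]; exact hy
          · exact Ideal.subset_span (by simp; tauto)
        · refine Ideal.span_le.mpr fun z hz => ?_
          simp only [Set.mem_ofPred_eq, List.mem_append, List.mem_cons] at hz
          rw [SetLike.mem_coe]
          rcases hz with rfl | hz
          · exact hxm
          · rw [h.1]; exact Ideal.subset_span (by simp; tauto)
      · refine le_trans (le_of_eq ?_) h.2
        congr 1
        simp; omega
    have hloc := isLocalRing_quot hxm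
    have hdom := ih (R ⧸ Ideal.span {x}) _ (by simp at hl ⊢; omega) (Rg_quot x _ hRg)
    have hprime : (Ideal.span {x}).IsPrime := (Ideal.Quotient.isDomain_iff_prime _).mp hdom
    obtain ⟨P, hP, hPx⟩ := Ideal.exists_minimalPrimes_le (bot_le : ⊥ ≤ Ideal.span {x})
    have hPp : P.IsPrime := hP.1.1
    have hP0 : P = ⊥ := by
      refine Submodule.eq_bot_of_le_smul_of_le_jacobson_bot (Ideal.span {x}) _
              (IsNoetherian.noetherian _) ?_ ?_
      · intro z hz
        obtain ⟨w, rfl⟩ := Ideal.mem_span_singleton'.mp (hPx hz)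
        rcases hPp.mem_or_mem hz with h1 | h1
        · rw [mul_comm]
          exact Submodule.smul_mem_smul (Ideal.mem_span_singleton_self x) h1
        · exact absurd h1 (hxP P hP)
      · refine le_trans ?_ (IsLocalRing.maximalIdeal_le_jacobson _)
        exact (Ideal.span_singleton_le_iff_mem _).mpr hxm
    rw [hP0] at hPp
    exact IsDomain.of_bot_isPrime R

open RingTheory.Sequence in
lemma Rg_regular : ∀ (n : ℕ) (R : Type u) [CommRing R] [IsNoetherianRing R]
    [IsLocalRing R] (l : List R), l.length = n → Rg R l → IsWeaklyRegular R l := by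
  intro n
  induction n with
  | zero =>
    intro R _ _ _ l hl h
    rw [List.length_eq_zero_iff.mp hl]
    exact IsWeaklyRegular.nil R R
  | succ n ih =>
    intro R _ _ _ l hl h
    obtain ⟨x, l, rfl⟩ := List.exists_cons_of_length_eq_add_one hl
    have hdom := Rg_domain _ R _ rfl h
    have hx : x ∈ maximalIdeal R := by rw [h.1]; exact Ideal.subset_span (by simp)
    have hx0 : x ≠ 0 := by
      rintro rfl
      have h1 := h.1
      rw [Ideal.ofList_cons, Ideal.span_singleton_eq_bot.mpr rfl, bot_sup_eq] at h1
      have := h.2.trans (dim_le_length _ h1)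
      simp only [List.length_cons] at this
      norm_cast at this
      omega
    have hloc := isLocalRing_quot hx
    have h2 := ih _ _ (by simpa using hl) (Rg_quot x l h)
    refine IsWeaklyRegular.cons ?_ ?_
    · exact fun a b hab => mul_left_cancel₀ hx0 hab
    · have h3 := (isWeaklyRegular_map_algebraMap_iff (R ⧸ Ideal.span {x})
        (R ⧸ Ideal.span {x}) l).mp h2
      refine (LinearEquiv.isWeaklyRegular_congr ?_ l).mp h3
      refine Submodule.quotEquivOfEq _ _ ?_
      rw [← Submodule.ideal_span_singleton_smul, smul_eq_mul, Ideal.mul_top]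


open RingTheory.Sequence in
lemma wr_snoc {R : Type*} [CommRing R] (l : List R) (x : R) :
    IsWeaklyRegular R (l ++ [x]) ↔ IsWeaklyRegular R l ∧
      ∀ r, x * r ∈ Ideal.ofList l → r ∈ Ideal.ofList l := by
  rw [isWeaklyRegular_append_iff, isWeaklyRegular_singleton_iff,
    isSMulRegular_quotient_iff_mem_of_smul_mem]
  simp

lemma ofList_perm {R : Type*} [CommRing R] {l l' : List R} (h : l.Perm l') :
    Ideal.ofList l = Ideal.ofList l' := by
  unfold Ideal.ofList
  congr 1
  ext x
  exact h.mem_iff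

lemma regular_pow_mem {R : Type*} [CommRing R] {J : Ideal R} {x : R}
    (h : ∀ r, x * r ∈ J → r ∈ J) (q : ℕ) : ∀ r, x ^ q * r ∈ J → r ∈ J := by
  induction q with
  | zero => intro r hr; simpa using hr
  | succ q ih =>
    intro r hr
    rw [pow_succ, mul_assoc] at hr
    exact h _ (ih _ hr)

open RingTheory.Sequence in
lemma regular_pow {R : Type*} [CommRing R] [IsNoetherianRing R] [IsLocalRing R] (q : ℕ) (hq : q ≠ 0)
    (rs : List R) : ∀ ss : List R, (∀ r ∈ rs ++ ss, r ∈ maximalIdeal R) →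
      IsWeaklyRegular R (rs ++ ss) → IsWeaklyRegular R (rs.map (· ^ q) ++ ss) ∧
        lam (Ideal.ofList (rs.map (· ^ q) ++ ss)) =
          (q ^ rs.length : ℕ) * lam (Ideal.ofList (rs ++ ss)) := by
  induction rs with
  | nil => intro ss _ h; simpa using h
  | cons r rs ih =>
    intro ss hm h
    have hp : (r :: rs ++ ss).Perm (rs ++ ss ++ [r]) := by
      rw [List.cons_append]
      exact (List.perm_append_singleton r _).symm
    have h1 := isWeaklyRegular_of_perm_of_subset_maximalIdeal h hp hm
    obtain ⟨h2, h3⟩ := (wr_snoc _ _).mp h1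
    have h4 : IsWeaklyRegular R (rs ++ ss ++ [r ^ q]) :=
      (wr_snoc _ _).mpr ⟨h2, regular_pow_mem h3 q⟩
    have hp2 : (rs ++ ss ++ [r ^ q]).Perm (rs ++ (r ^ q :: ss)) := by
      rw [List.append_assoc]
      exact List.Perm.append_left _ (List.perm_append_singleton _ _)
    have hrm : r ∈ maximalIdeal R := hm r (by simp)
    have hm2 : ∀ x ∈ rs ++ ss ++ [r ^ q], x ∈ maximalIdeal R := by
      intro x hx
      rw [List.mem_append, List.mem_singleton] at hx
      rcases hx with hx | rfl
      · exact hm x (by rw [List.cons_append]; exact List.mem_cons_of_mem _ hx)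
      · exact Ideal.pow_mem_of_mem _ hrm q (Nat.pos_of_ne_zero hq)
    have h5 := isWeaklyRegular_of_perm_of_subset_maximalIdeal h4 hp2 hm2
    have hm3 : ∀ x ∈ rs ++ (r ^ q :: ss), x ∈ maximalIdeal R :=
      fun x hx => hm2 x (hp2.mem_iff.mpr hx)
    obtain ⟨h6, h7⟩ := ih _ hm3 h5
    have hp3 : (rs.map (· ^ q) ++ (r ^ q :: ss)).Perm ((r :: rs).map (· ^ q) ++ ss) := by
      rw [List.map_cons, List.cons_append]
      exact List.perm_middle
    have hm4 : ∀ x ∈ rs.map (· ^ q) ++ (r ^ q :: ss), x ∈ maximalIdeal R := by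
      intro x hx
      rw [List.mem_append] at hx
      rcases hx with hx | hx
      · obtain ⟨y, hy, rfl⟩ := List.mem_map.mp hx
        exact Ideal.pow_mem_of_mem _ (hm y (by simp [hy])) q (Nat.pos_of_ne_zero hq)
      · exact hm3 x (List.mem_append_right _ hx)
    refine ⟨isWeaklyRegular_of_perm_of_subset_maximalIdeal h6 hp3 hm4, ?_⟩
    rw [← ofList_perm hp3, h7, ← ofList_perm hp2, ofList_perm hp, Ideal.ofList_append,
      Ideal.ofList_append (rs ++ ss), Ideal.ofList_singleton, Ideal.ofList_singleton,
      lam_pow _ _ h3, List.length_cons, pow_succ]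
    push_cast
    ring

/-- Data: length formula for Frobenius. -/
lemma frob_list {R : Type*} [CommRing R] (p : ℕ) [ExpChar R p] (e : ℕ) (l : List R) :
    (Ideal.ofList l).map (iterateFrobenius R p e) = Ideal.ofList (l.map (· ^ (p ^ e))) := by
  rw [Ideal.map_ofList]
  congr 1

lemma exists_pow_le_frob {R : Type*} [CommRing R] [IsNoetherianRing R] (p : ℕ) [ExpChar R p]
    (e : ℕ) (I J : Ideal R) {t : ℕ} (h : J ^ t ≤ I) :
    ∃ t', J ^ t' ≤ I.map (iterateFrobenius R p e) := by
  refine Ideal.exists_pow_le_of_le_radical_of_fg ?_ (IsNoetherian.noetherian _)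
  intro x hx
  refine ⟨t * p ^ e, ?_⟩
  rw [pow_mul]
  exact Ideal.mem_map_of_mem (iterateFrobenius R p e) (h (Ideal.pow_mem_pow hx t))

lemma map_cln_le {R : Type*} [CommRing R] (f : R →+* R) (I : Ideal R) (c : R) :
    (cln I c).map f ≤ cln (I.map f) (f c) := by
  rw [Ideal.map_le_iff_le_comap]
  intro r hr
  rw [Ideal.mem_comap, mem_cln, ← map_mul]
  exact Ideal.mem_map_of_mem f hr

lemma map_sup_span {R : Type*} [CommRing R] (f : R →+* R) (I : Ideal R) (c : R) :
    (I ⊔ Ideal.span {c}).map f = I.map f ⊔ Ideal.span {f c} := by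
  rw [Ideal.map_sup, Ideal.map_span, Set.image_singleton]

lemma lam_frob {R : Type u} [CommRing R] [IsNoetherianRing R] [IsLocalRing R] (p : ℕ) [ExpChar R p]
    (e : ℕ) (l : List R) (hl : Rg R l) (I : Ideal R) {t : ℕ} (ht : maximalIdeal R ^ t ≤ I) :
    lam (I.map (iterateFrobenius R p e)) = ((p ^ e) ^ l.length : ℕ) * lam I := by
  have hq : p ^ e ≠ 0 := pow_ne_zero _ (expChar_pos R p).ne'
  set N : ℕ := (p ^ e) ^ l.length with hN
  have hreg := Rg_regular _ R l rfl hl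
  have hlm : ∀ r ∈ l, r ∈ maximalIdeal R := by
    intro r hr; rw [hl.1]; exact Ideal.subset_span hr
  have hmax : lam ((maximalIdeal R).map (iterateFrobenius R p e)) = N := by
    have := (regular_pow (p ^ e) hq l [] (by simpa using hlm) (by simpa using hreg)).2
    rw [List.append_nil, List.append_nil, ← frob_list p e, ← hl.1, lam_max, mul_one] at this
    exact this
  -- upper bound
  have hub : ∀ I : Ideal R, ∀ t : ℕ, maximalIdeal R ^ t ≤ I →
      lam (I.map (iterateFrobenius R p e)) ≤ N * lam I := by
    intro I t ht
    refine socle_induction (P := fun I => lam (I.map (iterateFrobenius R p e)) ≤ N * lam I)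
      (by simp [Ideal.map_top, lam_top]) ?_ I ht
    intro I u hu hc h
    rw [lam_cln I u, lam_cln (I.map _) (iterateFrobenius R p e u), hc, lam_max, mul_add, mul_one,
      ← map_sup_span]
    refine add_le_add h ?_
    rw [← hmax, ← hc]
    exact lam_anti (map_cln_le _ _ _)
  -- base
  let J := Ideal.ofList (l.map (· ^ (t + 1)))
  have hJI : J ≤ I := by
    refine Ideal.span_le.mpr fun x hx => ?_
    obtain ⟨y, hy, rfl⟩ := List.mem_map.mp hx
    exact ht (Ideal.pow_le_pow_right (Nat.le_succ t) (Ideal.pow_mem_pow (hlm y hy) _))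
  have hJ : lam (J.map (iterateFrobenius R p e)) = N * lam J := by
    have h1 := (regular_pow (t + 1) (by omega) l [] (by simpa using hlm) (by simpa using hreg)).1
    rw [List.append_nil] at h1
    have h2 := (regular_pow (p ^ e) hq (l.map (· ^ (t + 1))) [] ?_ (by simpa using h1)).2
    · rw [List.append_nil, List.append_nil, ← frob_list p e, List.length_map] at h2
      exact h2
    · intro r hr
      rw [List.append_nil] at hr
      obtain ⟨y, hy, rfl⟩ := List.mem_map.mp hr
      exact Ideal.pow_mem_of_mem _ (hlm y hy) _ (by omega)
  obtain ⟨t', ht'⟩ : ∃ t', maximalIdeal R ^ t' ≤ J := by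
    refine Ideal.exists_pow_le_of_le_radical_of_fg ?_ (IsNoetherian.noetherian _)
    rw [hl.1]
    refine Ideal.span_le.mpr fun x hx => ⟨t + 1, Ideal.subset_span ?_⟩
    exact List.mem_map.mpr ⟨x, hx, rfl⟩
  -- maximal element
  obtain ⟨K, ⟨hJK, hKI, hK⟩, hKmax⟩ := set_has_maximal_iff_noetherian.mpr
    (inferInstance : IsNoetherian R R)
    {K : Ideal R | J ≤ K ∧ K ≤ I ∧ lam (K.map (iterateFrobenius R p e)) = N * lam K}
    ⟨J, le_rfl, hJI, hJ⟩
  rcases eq_or_lt_of_le hKI with rfl | hlt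
  · exact hK
  exfalso
  obtain ⟨u, huI, huK, hc⟩ := exists_socle hlt (ht'.trans hJK)
  refine hKmax (K ⊔ Ideal.span {u}) ⟨hJK.trans le_sup_left,
    sup_le hKI ((Ideal.span_singleton_le_iff_mem _).mpr huI), ?_⟩ ?_
  · refine le_antisymm (hub _ t' (ht'.trans (hJK.trans le_sup_left))) ?_
    have h1 := hK
    rw [lam_cln K u, lam_cln (Ideal.map (iterateFrobenius R p e) K) (iterateFrobenius R p e u), hc, lam_max, mul_add, mul_one,
      ← map_sup_span] at h1
    have h2 : lam (cln (Ideal.map (iterateFrobenius R p e) K) (iterateFrobenius R p e u)) ≤ N := by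
      rw [← hmax, ← hc]
      exact lam_anti (map_cln_le _ _ _)
    have h3 : (N : ℕ∞) * lam (K ⊔ Ideal.span {u}) + N ≤
        lam (Ideal.map (iterateFrobenius R p e) (K ⊔ Ideal.span {u})) + N := by
      rw [← h1]; gcongr
    exact (ENat.add_le_add_iff_right (ENat.natCast_ne_top N)).mp h3
  · refine lt_of_le_of_ne le_sup_left fun h => huK ?_
    rw [h]
    exact Ideal.mem_sup_right (Ideal.mem_span_singleton_self u)

/-- intersections, primary case -/
lemma frob_inf {R : Type u} [CommRing R] [IsNoetherianRing R] [IsLocalRing R] (p : ℕ) [ExpChar R p]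
    (e : ℕ) (l : List R) (hl : Rg R l) (I J : Ideal R) {t : ℕ} (hI : maximalIdeal R ^ t ≤ I)
    (hJ : maximalIdeal R ^ t ≤ J) :
    (I ⊓ J).map (iterateFrobenius R p e) =
      I.map (iterateFrobenius R p e) ⊓ J.map (iterateFrobenius R p e) := by
  obtain ⟨t', ht'⟩ := exists_pow_le_frob p e (I ⊓ J) (maximalIdeal R) (le_inf hI hJ)
  refine eq_of_lam (le_inf (Ideal.map_mono inf_le_left) (Ideal.map_mono inf_le_right))
    (lam_ne_top _ ht') ?_
  have h1 := lam_inf_sup (I.map (iterateFrobenius R p e)) (J.map (iterateFrobenius R p e))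
  rw [← Ideal.map_sup, lam_frob p e l hl I hI, lam_frob p e l hl J hJ,
    lam_frob p e l hl (I ⊔ J) (hI.trans le_sup_left), ← mul_add, lam_inf_sup I J, mul_add,
    ← lam_frob p e l hl (I ⊓ J) (le_inf hI hJ)] at h1
  refine ((ENat.add_le_add_iff_right ?_).mp h1.le)
  rw [← lam_frob p e l hl (I ⊔ J) (hI.trans le_sup_left)]
  obtain ⟨t', ht'⟩ := exists_pow_le_frob p e (I ⊔ J) (maximalIdeal R) (hI.trans le_sup_left)
  exact lam_ne_top _ ht'

lemma frob_cln {R : Type u} [CommRing R] [IsNoetherianRing R] [IsLocalRing R] (p : ℕ) [ExpChar R p]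
    (e : ℕ) (l : List R) (hl : Rg R l) (I : Ideal R) (c : R) {t : ℕ} (hI : maximalIdeal R ^ t ≤ I) :
    (cln I c).map (iterateFrobenius R p e) =
      cln (I.map (iterateFrobenius R p e)) (iterateFrobenius R p e c) := by
  have hc : maximalIdeal R ^ t ≤ cln I c := fun r hr => I.mul_mem_left _ (hI hr)
  obtain ⟨t', ht'⟩ := exists_pow_le_frob p e _ (maximalIdeal R) hc
  refine eq_of_lam (map_cln_le _ _ _) (lam_ne_top _ ht') ?_
  have h1 := lam_cln (I.map (iterateFrobenius R p e)) (iterateFrobenius R p e c)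
  rw [← map_sup_span, lam_frob p e l hl I hI,
    lam_frob p e l hl (I ⊔ _) (hI.trans le_sup_left), lam_cln I c, mul_add,
    ← lam_frob p e l hl (cln I c) hc] at h1
  refine ((ENat.add_le_add_iff_left ?_).mp h1.le)
  rw [← lam_frob p e l hl (I ⊔ _) (hI.trans le_sup_left)]
  obtain ⟨t', ht'⟩ := exists_pow_le_frob p e (I ⊔ Ideal.span {c}) (maximalIdeal R)
    (hI.trans le_sup_left)
  exact lam_ne_top _ ht'


lemma krull_closed {R : Type*} [CommRing R] [IsNoetherianRing R] [IsLocalRing R] (I : Ideal R)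
    (y : R) (h : ∀ n, y ∈ I ⊔ maximalIdeal R ^ n) : y ∈ I := by
  have h1 := Ideal.iInf_pow_smul_eq_bot_of_isLocalRing (M := R ⧸ I) (maximalIdeal R)
    (maximalIdeal.isMaximal R).ne_top
  have h2 : (Submodule.Quotient.mk y : R ⧸ I) ∈
      (⨅ i : ℕ, maximalIdeal R ^ i • ⊤ : Submodule R (R ⧸ I)) := by
    rw [Submodule.mem_iInf]
    intro n
    obtain ⟨a, ha, b, hb, hab⟩ := Submodule.mem_sup.mp (h n)
    have : (Submodule.Quotient.mk y : R ⧸ I) = b • Submodule.Quotient.mk 1 := by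
      rw [← Submodule.Quotient.mk_smul, Submodule.Quotient.eq, ← hab]
      simpa using ha
    rw [this]
    exact Submodule.smul_mem_smul hb trivial
  rw [h1, Submodule.mem_bot, Submodule.Quotient.mk_eq_zero] at h2
  exact h2

lemma chev_step {R : Type*} [CommRing R] [IsNoetherianRing R] [IsLocalRing R]
    (S : Set (Ideal R)) (hne : S.Nonempty) (hd : ∀ I ∈ S, ∀ J ∈ S, I ⊓ J ∈ S) (k : ℕ) :
    ∃ I ∈ S, ∀ J ∈ S, I ≤ J ⊔ maximalIdeal R ^ k := by
  have hfin : ∀ I : Ideal R, lam (I ⊔ maximalIdeal R ^ k) ≠ ⊤ :=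
    fun I => lam_ne_top _ (t := k) le_sup_right
  have hB : ∀ I : Ideal R, (lam (I ⊔ maximalIdeal R ^ k)).toNat ≤
      (lam (maximalIdeal R ^ k)).toNat := fun I =>
    ENat.toNat_le_toNat (lam_anti le_sup_right) (lam_ne_top _ (t := k) le_rfl)
  obtain ⟨I, hI, hmin⟩ := (measure (fun I : Ideal R => (lam (maximalIdeal R ^ k)).toNat -
    (lam (I ⊔ maximalIdeal R ^ k)).toNat)).wf.has_min S hne
  refine ⟨I, hI, fun J hJ => ?_⟩
  have h1 := hmin _ (hd I hI J hJ)
  have hle : I ⊓ J ⊔ maximalIdeal R ^ k ≤ I ⊔ maximalIdeal R ^ k := sup_le_sup_right inf_le_left _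
  have h2 : (lam (I ⊓ J ⊔ maximalIdeal R ^ k)).toNat ≤ (lam (I ⊔ maximalIdeal R ^ k)).toNat := by
    have h3 := hB I
    have h4 := hB (I ⊓ J)
    simp only [measure, invImage, InvImage, WellFoundedRelation.rel] at h1
    change ¬ (_ < _) at h1
    omega
  have h3 := eq_of_lam hle (hfin _) (by
    rw [← ENat.natCast_toNat (hfin (I ⊓ J)), ← ENat.natCast_toNat (hfin I)]
    exact_mod_cast h2)
  calc I ≤ I ⊔ maximalIdeal R ^ k := le_sup_left
    _ = _ := h3.symm
    _ ≤ _ := sup_le_sup_right inf_le_right _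

lemma chevalley {R : Type*} [CommRing R] [IsNoetherianRing R] [IsLocalRing R]
    [IsAdicComplete (maximalIdeal R) R]
    (S : Set (Ideal R)) (hne : S.Nonempty) (hd : ∀ I ∈ S, ∀ J ∈ S, I ⊓ J ∈ S) (t : ℕ) :
    ∃ I ∈ S, I ≤ sInf S ⊔ maximalIdeal R ^ t := by
  choose A hAS hA using chev_step S hne hd
  refine ⟨A t, hAS t, fun x hx => ?_⟩
  have hstep : ∀ n : ℕ, ∀ z : A (t + n), ∃ w : A (t + (n + 1)),
      (z : R) - w ∈ maximalIdeal R ^ (t + n) := by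
    intro n z
    obtain ⟨a, ha, b, hb, hab⟩ := Submodule.mem_sup.mp (hA (t + n) _ (hAS (t + (n + 1))) z.2)
    exact ⟨⟨a, ha⟩, by rw [← hab]; simpa using hb⟩
  choose nx hnx using hstep
  let X : (n : ℕ) → A (t + n) := fun n => Nat.rec (motive := fun n => A (t + n)) ⟨x, hx⟩ nx n
  have hX : ∀ n, (X n : R) - X (n + 1) ∈ maximalIdeal R ^ (t + n) := fun n => hnx n (X n)
  have hX2 : ∀ m n, m ≤ n → (X m : R) - X n ∈ maximalIdeal R ^ (t + m) := by
    intro m n hmn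
    induction n, hmn using Nat.le_induction with
    | base => simp
    | succ n hmn ih =>
      have := Ideal.add_mem _ ih (Ideal.pow_le_pow_right (by omega) (hX n))
      simpa using this
  obtain ⟨y, hy⟩ := IsPrecomplete.prec (I := maximalIdeal R) (M := R) inferInstance
    (f := fun n => (X n : R)) (by
      intro m n hmn
      rw [SModEq.sub_mem, smul_eq_mul, Ideal.mul_top]
      exact Ideal.pow_le_pow_right (by omega) (hX2 m n hmn))
  simp only [SModEq.sub_mem, smul_eq_mul, Ideal.mul_top] at hy
  have hyS : y ∈ sInf S := by
    rw [Submodule.mem_sInf]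
    intro I hI
    refine krull_closed I y fun n => ?_
    have h1 : (X n : R) ∈ I ⊔ maximalIdeal R ^ n :=
      sup_le_sup_left (Ideal.pow_le_pow_right (by omega)) I (hA (t + n) I hI (X n).2)
    have h2 := Ideal.sub_mem _ h1 (Ideal.mem_sup_right (S := I) (hy n))
    simpa using h2
  have hxy : x - y ∈ maximalIdeal R ^ t := by
    have h1 : x - X t ∈ maximalIdeal R ^ t := hX2 0 t (Nat.zero_le _)
    have := Ideal.add_mem _ h1 (hy t)
    simpa using this
  have := Ideal.add_mem _ (Ideal.mem_sup_left (T := maximalIdeal R ^ t) hyS)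
    (Ideal.mem_sup_right (S := sInf S) hxy)
  simpa using this

lemma frob_sup_pow_le {R : Type*} [CommRing R] [IsLocalRing R] (p : ℕ) [ExpChar R p]
    (e : ℕ) (J : Ideal R) (t : ℕ) : (J ⊔ maximalIdeal R ^ t).map (iterateFrobenius R p e) ≤
      J.map (iterateFrobenius R p e) ⊔ maximalIdeal R ^ t := by
  rw [Ideal.map_sup]
  refine sup_le_sup_left ?_ _
  rw [Ideal.map_le_iff_le_comap]
  intro x hx
  rw [Ideal.mem_comap, iterateFrobenius_def]
  exact Ideal.pow_mem_of_mem _ hx _ (pow_pos (expChar_pos R p) _)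

/-- a directed family of ideals -/
lemma frob_sInf_directed {R : Type*} [CommRing R] [IsNoetherianRing R] [IsLocalRing R]
    [IsAdicComplete (maximalIdeal R) R] (p : ℕ) [ExpChar R p] (e : ℕ)
    (S : Set (Ideal R)) (hne : S.Nonempty) (hd : ∀ I ∈ S, ∀ J ∈ S, I ⊓ J ∈ S) (r : R)
    (hr : ∀ I ∈ S, r ∈ I.map (iterateFrobenius R p e)) :
    r ∈ (sInf S).map (iterateFrobenius R p e) := by
  refine krull_closed _ r fun t => ?_
  obtain ⟨I, hI, hle⟩ := chevalley S hne hd t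
  exact frob_sup_pow_le p e _ t (Ideal.map_mono hle (hr I hI))

lemma frob_star {R : Type u} [CommRing R] [IsNoetherianRing R] [IsLocalRing R]
    [IsAdicComplete (maximalIdeal R) R] (p : ℕ) [ExpChar R p] (e : ℕ) (l : List R) (hl : Rg R l)
    (S : Set (Ideal R)) (r : R)
    (hr : ∀ I ∈ S, r ∈ I.map (iterateFrobenius R p e)) :
    r ∈ (sInf S).map (iterateFrobenius R p e) := by
  let T : Set (Ideal R) := {J | ∃ t, maximalIdeal R ^ t ≤ J ∧ r ∈ J.map (iterateFrobenius R p e)}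
  have h1 : r ∈ (sInf T).map (iterateFrobenius R p e) := by
    refine frob_sInf_directed p e T ⟨⊤, 0, le_top, by simp [Ideal.map_top]⟩ ?_ r
      (fun I hI => hI.choose_spec.2)
    rintro I ⟨t, ht, hI⟩ J ⟨s, hs, hJ⟩
    have a1 : maximalIdeal R ^ (t + s) ≤ I := (Ideal.pow_le_pow_right (by omega)).trans ht
    have a2 : maximalIdeal R ^ (t + s) ≤ J := (Ideal.pow_le_pow_right (by omega)).trans hs
    refine ⟨t + s, le_inf a1 a2, ?_⟩
    rw [frob_inf p e l hl I J a1 a2]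
    exact ⟨hI, hJ⟩
  refine Ideal.map_mono ?_ h1
  refine le_sInf fun I hI y hy => krull_closed I y fun n => ?_
  have : sInf T ≤ I ⊔ maximalIdeal R ^ n :=
    sInf_le ⟨n, le_sup_right, Ideal.map_mono le_sup_left (hr I hI)⟩
  exact this hy

lemma frob_colon {R : Type u} [CommRing R] [IsNoetherianRing R] [IsLocalRing R]
    [IsAdicComplete (maximalIdeal R) R] (p : ℕ) [ExpChar R p] (e : ℕ) (l : List R) (hl : Rg R l)
    (I : Ideal R) (c r : R)
    (hr : iterateFrobenius R p e c * r ∈ I.map (iterateFrobenius R p e)) :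
    r ∈ (cln I c).map (iterateFrobenius R p e) := by
  have h1 := frob_star p e l hl (Set.range fun t : ℕ => cln (I ⊔ maximalIdeal R ^ t) c) r (by
    rintro _ ⟨t, rfl⟩
    rw [frob_cln p e l hl (I ⊔ maximalIdeal R ^ t) c (t := t) le_sup_right]
    exact Ideal.map_mono le_sup_left hr)
  refine Ideal.map_mono ?_ h1
  intro y hy
  rw [Submodule.mem_sInf] at hy
  exact krull_closed I _ fun n => hy _ ⟨n, rfl⟩


/-- colon of two ideals -/
def col {R : Type*} [CommRing R] (K L : Ideal R) : Ideal R := ⨅ x : L, cln K x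

lemma mem_col {R : Type*} [CommRing R] {K L : Ideal R} {r : R} :
    r ∈ col K L ↔ ∀ x ∈ L, x * r ∈ K := by
  simp [col, Submodule.mem_iInf, mem_cln]

lemma chain_local {R : Type*} [CommRing R] [IsNoetherianRing R] [IsLocalRing R] (K L : Ideal R)
    (t : ℕ) (ht : maximalIdeal R ^ t * L ≤ K) (M : ℕ → Ideal R) (hM : Antitone M)
    (hK : ∀ n, K ≤ M n) (hL : ∀ n, M n ≤ L) : ∃ s, M s ≤ M (s + 1) := by
  obtain ⟨k, hk⟩ := Ideal.exists_pow_inf_eq_pow_smul (M := R) (maximalIdeal R) L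
  have h1 := hk (k + t) (by omega)
  have h2 : maximalIdeal R ^ (k + t) ⊓ L ≤ K := by
    rw [smul_eq_mul, Ideal.mul_top, Nat.add_sub_cancel_left] at h1
    rw [h1, smul_eq_mul]
    exact (Ideal.mul_mono_right inf_le_right).trans ht
  obtain ⟨I, ⟨s, rfl⟩, hs⟩ := chev_step (Set.range M) ⟨M 0, 0, rfl⟩ (by
    rintro _ ⟨a, rfl⟩ _ ⟨b, rfl⟩
    rcases le_total a b with h | h
    · exact ⟨b, (inf_eq_right.mpr (hM h)).symm⟩
    · exact ⟨a, (inf_eq_left.mpr (hM h)).symm⟩) (k + t)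
  refine ⟨s, fun x hx => ?_⟩
  obtain ⟨a, ha, b, hb, rfl⟩ := Submodule.mem_sup.mp (hs _ ⟨s + 1, rfl⟩ hx)
  refine Ideal.add_mem _ ha (hK _ (h2 ⟨hb, ?_⟩))
  have := Ideal.sub_mem _ (hL _ hx) (hL _ ha)
  simpa using this

lemma exists_common {R : Type*} [CommRing R] [IsNoetherianRing R] (P M N : Ideal R) [P.IsPrime]
    (h : ∀ x ∈ N, ∃ d, d ∉ P ∧ d * x ∈ M) : ∃ c, c ∉ P ∧ ∀ x ∈ N, c * x ∈ M := by
  classical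
  obtain ⟨T, hT⟩ := IsNoetherian.noetherian N
  have hTN : ∀ x ∈ T, x ∈ N := fun x hx => hT ▸ Ideal.subset_span hx
  choose! d hd hdx using h
  refine ⟨∏ x ∈ T, d x, ?_, ?_⟩
  · intro hp
    obtain ⟨x, hx, hxP⟩ := (Ideal.IsPrime.prod_mem_iff (p := P)).mp hp
    exact hd x (hTN x hx) hxP
  · have : N ≤ cln M (∏ x ∈ T, d x) := by
      rw [← hT]
      refine Ideal.span_le.mpr fun x hx => ?_
      rw [SetLike.mem_coe, mem_cln, ← Finset.prod_erase_mul T d hx, mul_assoc]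
      exact M.mul_mem_left _ (hdx x (hTN x hx))
    exact this

lemma chain_prime {R : Type*} [CommRing R] [IsNoetherianRing R] (K L P : Ideal R)
    (hP : P ∈ (col K L).minimalPrimes) (M : ℕ → Ideal R) (hM : Antitone M)
    (hK : ∀ n, K ≤ M n) (hL : ∀ n, M n ≤ L) :
    ∃ s c, c ∉ P ∧ ∀ x ∈ M s, c * x ∈ M (s + 1) := by
  have : P.IsPrime := hP.1.1
  let S := Localization.AtPrime P
  have : IsNoetherianRing S := IsLocalization.isNoetherianRing P.primeCompl S inferInstance
  have hr := IsLocalization.AtPrime.radical_map_of_mem_minimalPrimes S P _ hP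
  rw [IsLocalization.AtPrime.map_eq_maximalIdeal P S] at hr
  obtain ⟨t, ht⟩ := Ideal.exists_pow_le_of_le_radical_of_fg
    (I := maximalIdeal S) (J := (col K L).map (algebraMap R S)) hr.ge (IsNoetherian.noetherian _)
  obtain ⟨s, hs⟩ := chain_local (K.map (algebraMap R S)) (L.map (algebraMap R S)) t (by
    refine (Ideal.mul_mono_left ht).trans ?_
    rw [← Ideal.map_mul]
    refine Ideal.map_mono (Ideal.mul_le.mpr fun r hr x hx => ?_)
    rw [mul_comm]
    exact mem_col.mp hr x hx) (fun n => (M n).map (algebraMap R S))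
    (fun a b h => Ideal.map_mono (hM h)) (fun n => Ideal.map_mono (hK n))
    (fun n => Ideal.map_mono (hL n))
  refine ⟨s, exists_common P (M (s + 1)) (M s) fun x hx => ?_⟩
  obtain ⟨⟨y, d⟩, hyd⟩ := (IsLocalization.mem_map_algebraMap_iff P.primeCompl S).mp
    (hs (Ideal.mem_map_of_mem _ hx))
  simp only at hyd
  rw [← map_mul] at hyd
  obtain ⟨w, hw⟩ := (IsLocalization.eq_iff_exists P.primeCompl S).mp hyd
  refine ⟨w * d, (w * d).2, ?_⟩
  have : (w : R) * d * x = w * y := by rw [← hw]; ring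
  rw [this]
  exact Ideal.mul_mem_left _ _ y.2

lemma stab {R : Type*} [CommRing R] [IsNoetherianRing R] (q : ℕ) (hq : 2 ≤ q)
    (C : Ideal R → Ideal R) (hmono : Monotone C)
    (hC : ∀ c J, Ideal.span {c} * C J ≤ C (Ideal.span {c ^ q} * J)) (I : Ideal R) :
    ∀ K L, col K L = I → C K = K → K ≤ L → C L ≤ L → ∃ s, ∀ n, s ≤ n → C^[n] L = C^[s] L := by
  induction I using WellFoundedGT.induction with
  | ind I ih =>
  intro K L hI hK hKL hCL
  have hanti : Antitone (fun n => C^[n] L) := by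
    refine antitone_nat_of_succ_le fun n => ?_
    rw [Function.iterate_succ_apply]
    exact (hmono.iterate n) hCL
  have hKn : ∀ n, K ≤ C^[n] L := by
    intro n
    have := hmono.iterate n hKL
    rwa [Function.iterate_fixed hK] at this
  by_cases htop : I = ⊤
  · have hLK : L ≤ K := fun x hx => by
      have : (1 : R) ∈ col K L := by rw [hI, htop]; trivial
      simpa using mem_col.mp this x hx
    refine ⟨0, fun n _ => le_antisymm (hanti (Nat.zero_le n)) (hLK.trans (hKn n))⟩
  obtain ⟨P, hP⟩ := Ideal.nonempty_minimalPrimes htop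
  obtain ⟨s, c, hcP, hc⟩ := chain_prime K L P (hI ▸ hP) (fun n => C^[n] L) hanti hKn
    (fun n => hanti (Nat.zero_le n))
  have : P.IsPrime := hP.1.1
  set L' := C^[s] L with hL'
  have hc' : ∀ x ∈ L', c * x ∈ C L' := by
    intro x hx
    have := hc x hx
    simpa only [Function.iterate_succ_apply'] using this
  set K0 := K ⊔ Ideal.span {c ^ 2} * L' with hK0
  have hCL' : C L' ≤ L' := by
    have := hanti (Nat.le_succ s)
    simpa only [Function.iterate_succ_apply'] using this
  have h0 : K0 ≤ C K0 := by
    refine sup_le ?_ ?_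
    · exact hK.ge.trans (hmono le_sup_left)
    · have e1 : Ideal.span {c ^ 2} * L' ≤ Ideal.span {c} * C L' := by
        rw [pow_two, ← Ideal.span_singleton_mul_span_singleton, mul_assoc]
        refine Ideal.mul_mono_right ?_
        rw [Ideal.span_singleton_mul_le_iff]
        exact hc'
      have e2 : Ideal.span {c ^ q} * L' ≤ K0 := by
        refine le_trans (Ideal.mul_mono_left ?_) le_sup_right
        rw [Ideal.span_singleton_le_span_singleton]
        exact pow_dvd_pow c hq
      exact e1.trans ((hC c L').trans (hmono e2))
  have hKL' : K0 ≤ L' := sup_le (hKn s) Ideal.mul_le_right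
  have hm : Monotone (fun n => C^[n] K0) := by
    refine monotone_nat_of_le_succ fun n => ?_
    rw [Function.iterate_succ_apply]
    exact (hmono.iterate n) h0
  obtain ⟨j, hj⟩ := monotone_stabilizes_iff_noetherian.mpr (inferInstance : IsNoetherian R R)
    ⟨_, hm⟩
  set K' := C^[j] K0 with hK'
  have hK'C : C K' = K' := by
    have := hj (j + 1) (by omega)
    simp only [OrderHom.coe_mk, Function.iterate_succ_apply'] at this
    exact this.symm
  have hK0K' : K0 ≤ K' := hm (Nat.zero_le j)
  have hK'L' : K' ≤ L' := by
    have a1 : ∀ n, C^[n] L' ≤ L' := by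
      intro n
      rw [hL', ← Function.iterate_add_apply]
      exact hanti (by omega)
    exact (hmono.iterate j hKL').trans (a1 j)
  have hlt : I < col K' L' := by
    refine lt_of_le_of_ne ?_ ?_
    · rw [← hI]
      intro r hr
      rw [mem_col] at hr ⊢
      exact fun x hx => hK0K' (Ideal.mem_sup_left (hr x (hanti (Nat.zero_le s) hx)))
    · intro heq
      have : c ^ 2 ∈ I := by
        rw [heq, mem_col]
        intro x hx
        refine hK0K' (Ideal.mem_sup_right ?_)
        rw [mul_comm x (c ^ 2)]
        exact Ideal.mul_mem_mul (Ideal.mem_span_singleton_self _) hx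
      exact hcP (Ideal.IsPrime.mem_of_pow_mem ‹_› 2 (hP.1.2 this))
  obtain ⟨n0, hn0⟩ := ih _ hlt K' L' rfl hK'C hK'L' hCL'
  refine ⟨n0 + s, fun n hn => ?_⟩
  have := hn0 (n - s) (by omega)
  rw [hL', ← Function.iterate_add_apply, ← Function.iterate_add_apply,
    Nat.sub_add_cancel (by omega)] at this
  exact this


lemma bracketPow_eq {R : Type*} [CommRing R] (p : ℕ) [ExpChar R p] (I : Ideal R) (e : ℕ) :
    bracketPow I (p ^ e) = I.map (iterateFrobenius R p e) := rfl

lemma frob_map_map {R : Type*} [CommRing R] (p : ℕ) [ExpChar R p] (I : Ideal R) (m n : ℕ) :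
    (I.map (iterateFrobenius R p m)).map (iterateFrobenius R p n) =
      I.map (iterateFrobenius R p (m + n)) := by
  rw [Ideal.map_map]
  congr 1
  ext x
  simp [iterateFrobenius_def, pow_add, pow_mul]

lemma Ie_span {R : Type*} [CommRing R] (p : ℕ) [ExpChar R p] (h : R) (e : ℕ) :
    Ie p (Ideal.span {h}) e = sInf {I : Ideal R | h ∈ I.map (iterateFrobenius R p e)} := by
  unfold Ie
  congr 1
  ext I
  rw [Set.mem_setOf_eq, Set.mem_setOf_eq, bracketPow_eq, Ideal.span_singleton_le_iff_mem]

/-- The Cartier-type operator `J ↦ I_e(f J)`. -/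
noncomputable def opC {R : Type*} [CommRing R] (p : ℕ) [ExpChar R p] (f : R) (e : ℕ)
    (J : Ideal R) : Ideal R :=
  sInf {I : Ideal R | ∀ x ∈ J, f * x ∈ I.map (iterateFrobenius R p e)}

lemma opC_mono {R : Type*} [CommRing R] (p : ℕ) [ExpChar R p] (f : R) (e : ℕ) :
    Monotone (opC p f e) := fun _ _ h => sInf_le_sInf fun _ hI x hx => hI x (h hx)

lemma opC_bot {R : Type*} [CommRing R] (p : ℕ) [ExpChar R p] (f : R) (e : ℕ) :
    opC p f e ⊥ = ⊥ := by
  refine le_bot_iff.mp (sInf_le ?_)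
  intro x hx
  rw [Ideal.mem_bot.mp hx, mul_zero]
  exact Ideal.zero_mem _

lemma opC_mul {R : Type u} [CommRing R] [IsNoetherianRing R] [IsLocalRing R]
    [IsAdicComplete (maximalIdeal R) R] (p : ℕ) [ExpChar R p] (e : ℕ) (l : List R) (hl : Rg R l)
    (f c : R) (J : Ideal R) :
    Ideal.span {c} * opC p f e J ≤ opC p f e (Ideal.span {c ^ (p ^ e)} * J) := by
  refine le_sInf fun I hI => ?_
  rw [Ideal.span_singleton_mul_le_iff]
  have h : opC p f e J ≤ cln I c := by
    refine sInf_le fun x hx => frob_colon p e l hl I c _ ?_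
    have := hI (c ^ (p ^ e) * x) (Ideal.mul_mem_mul (Ideal.mem_span_singleton_self _) hx)
    rw [iterateFrobenius_def, mul_left_comm]
    exact this
  exact fun x hx => h hx

lemma opC_step {R : Type u} [CommRing R] [IsNoetherianRing R] [IsLocalRing R]
    [IsAdicComplete (maximalIdeal R) R] (p : ℕ) [ExpChar R p] (l : List R) (hl : Rg R l)
    (g : R) (a β s : ℕ) :
    opC p (g ^ a) β (Ie p (Ideal.span {g ^ (a * psi p β s)}) (s * β)) =
      Ie p (Ideal.span {g ^ (a * psi p β (s + 1))}) ((s + 1) * β) := by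
  have hpow : g ^ (a * psi p β (s + 1)) =
      iterateFrobenius R p (s * β) (g ^ a) * g ^ (a * psi p β s) := by
    rw [iterateFrobenius_def, psi, Finset.sum_range_succ, ← psi, mul_add, pow_add, pow_mul g a,
      pow_mul g a, mul_comm, mul_comm β s]
  rw [Ie_span p (g ^ (a * psi p β (s + 1)))]
  unfold opC
  congr 1
  ext I
  rw [Set.mem_setOf_eq, Set.mem_setOf_eq, add_mul, one_mul, add_comm (s * β), ← frob_map_map, hpow]
  constructor
  · intro h
    have h1 : g ^ (a * psi p β s) ∈
        (Ie p (Ideal.span {g ^ (a * psi p β s)}) (s * β)).map (iterateFrobenius R p (s * β)) := by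
      rw [Ie_span]
      exact frob_star p _ l hl _ _ fun I hI => hI
    have h2 : Ie p (Ideal.span {g ^ (a * psi p β s)}) (s * β) ≤
        cln (I.map (iterateFrobenius R p β)) (g ^ a) := h
    exact map_cln_le _ _ _ (Ideal.map_mono h2 h1)
  · intro h
    have h1 := frob_colon p (s * β) l hl _ _ _ h
    have h2 : Ie p (Ideal.span {g ^ (a * psi p β s)}) (s * β) ≤
        cln (I.map (iterateFrobenius R p β)) (g ^ a) := by
      rw [Ie_span]
      exact sInf_le h1
    exact h2

lemma opC_iter {R : Type u} [CommRing R] [IsNoetherianRing R] [IsLocalRing R]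
    [IsAdicComplete (maximalIdeal R) R] (p : ℕ) [ExpChar R p] (l : List R) (hl : Rg R l)
    (g : R) (a β s : ℕ) :
    Ie p (Ideal.span {g ^ (a * psi p β s)}) (s * β) = (opC p (g ^ a) β)^[s] ⊤ := by
  induction s with
  | zero =>
    rw [Ie_span, Function.iterate_zero_apply, eq_top_iff]
    refine le_sInf fun I hI => ?_
    have h1 : I.map (iterateFrobenius R p (0 * β)) ≤ I := by
      rw [Ideal.map_le_iff_le_comap]
      intro x hx
      rw [Ideal.mem_comap, iterateFrobenius_def, zero_mul, pow_zero, pow_one]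
      exact hx
    have h2 := h1 hI
    rw [psi, Finset.sum_range_zero, mul_zero, pow_zero] at h2
    rw [(Ideal.eq_top_iff_one I).mpr h2]
  | succ s ih =>
    rw [Function.iterate_succ_apply', ← ih, opC_step p l hl]

/-- The ideals `I_{sβ}(g^{a ψ_s(p^β)})` form a descending chain which stabilizes. -/
theorem stmt13 {R : Type*} [CommRing R] [IsNoetherianRing R] [IsLocalRing R]
    [IsAdicComplete (IsLocalRing.maximalIdeal R) R]
    (p : ℕ) (hp : p.Prime) [CharP R p]
    (hreg : IsRegularStmt R) (g : R) (a β : ℕ) (hβ : 1 ≤ β) :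
    (∀ s : ℕ, 1 ≤ s →
      Ie p (Ideal.span {g ^ (a * psi p β (s + 1))}) ((s + 1) * β) ≤
        Ie p (Ideal.span {g ^ (a * psi p β s)}) (s * β)) ∧
    ∃ s₀ : ℕ, 1 ≤ s₀ ∧ ∀ s : ℕ, s₀ ≤ s →
      Ie p (Ideal.span {g ^ (a * psi p β s)}) (s * β) =
        Ie p (Ideal.span {g ^ (a * psi p β s₀)}) (s₀ * β) := by
  have : ExpChar R p := ExpChar.prime hp
  obtain ⟨S, hS1, hS2⟩ := hreg
  have hl : Rg R S.toList := by
    refine ⟨?_, ?_⟩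
    · rw [hS1, Ideal.ofList]
      congr 1
      ext x
      simp
    · rw [Finset.length_toList]
      exact hS2.le
  have hmono := opC_mono p (g ^ a) β
  simp only [opC_iter p _ hl]
  refine ⟨fun s _ => ?_, ?_⟩
  · rw [Function.iterate_succ_apply]
    exact hmono.iterate s le_top
  · have hq : 2 ≤ p ^ β := hp.two_le.trans (Nat.le_self_pow (by omega) p)
    obtain ⟨n, hn⟩ := stab (p ^ β) hq (opC p (g ^ a) β) hmono
      (fun c J => opC_mul p β _ hl (g ^ a) c J) _ ⊥ ⊤ rfl (opC_bot p _ β) bot_le le_top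
    refine ⟨n + 1, by omega, fun s hs => ?_⟩
    rw [hn s (by omega), hn (n + 1) (by omega)]
end

section
/- Let R be a Noetherian regular local ring of prime characteristic p > 0 satisfying condition (*), let a be an ideal of R, and let c be a non-negative real number. Then I_1(τ(a^{pc})) = τ(a^c). -/
universe u

theorem bp_eq_map {R : Type*} [CommRing R] (p : ℕ) [Fact p.Prime] [CharP R p]
    (J : Ideal R) (e : ℕ) : bracketPow J (p ^ e) = J.map (iterateFrobenius R p e) := by
  unfold bracketPow Ideal.map
  congr 1

theorem bp_bp {R : Type*} [CommRing R] (p : ℕ) [Fact p.Prime] [CharP R p]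
    (J : Ideal R) (e : ℕ) :
    bracketPow (bracketPow J (p ^ 1)) (p ^ e) = bracketPow J (p ^ (e + 1)) := by
  rw [bp_eq_map, bp_eq_map, bp_eq_map, Ideal.map_map]
  congr 1
  ext x
  rw [RingHom.comp_apply, iterateFrobenius_def, iterateFrobenius_def, iterateFrobenius_def,
    ← pow_mul, ← pow_add, add_comm]

theorem bp_mono {R : Type*} [CommRing R] {I J : Ideal R} (h : I ≤ J) (q : ℕ) :
    bracketPow I q ≤ bracketPow J q :=
  Ideal.span_mono (Set.image_mono h)

theorem Ie_le_iff {R : Type*} [CommRing R] {p : ℕ} (hstar : CondStar R p) (a J : Ideal R)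
    {e : ℕ} (he : 1 ≤ e) : Ie p a e ≤ J ↔ a ≤ bracketPow J (p ^ e) :=
  ⟨fun h => (hstar a e he).trans (bp_mono h _), fun h => sInf_le h⟩

theorem Ie_Ie {R : Type*} [CommRing R] {p : ℕ} [Fact p.Prime] [CharP R p]
    (hstar : CondStar R p) (a : Ideal R) {e : ℕ} (he : 1 ≤ e) :
    Ie p (Ie p a e) 1 = Ie p a (e + 1) := by
  apply eq_of_forall_ge_iff
  intro J
  rw [Ie_le_iff hstar _ _ le_rfl, Ie_le_iff hstar _ _ he, Ie_le_iff hstar _ _ (by omega), bp_bp]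

theorem mem_of_pow_mem {R : Type*} [CommRing R] [IsLocalRing R] [IsReduced R] {p : ℕ}
    (hstar : CondStar R p) (hp : 0 < p)
    (K : Ideal R) (x : R) (hx : x ^ p ∈ bracketPow K p) : x ∈ K := by
  by_contra hxK
  have h1 : Ie p (Ideal.span {x ^ p}) 1 ≤ Ideal.span {x} ⊓ K := by
    refine le_inf (sInf_le ?_) (sInf_le ?_)
    · show Ideal.span {x ^ p} ≤ _
      rw [pow_one, Ideal.span_singleton_le_iff_mem]
      exact Ideal.subset_span ⟨x, Ideal.mem_span_singleton_self x, rfl⟩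
    · show Ideal.span {x ^ p} ≤ _
      rw [pow_one, Ideal.span_singleton_le_iff_mem]
      exact hx
  have h2 : x ^ p ∈ bracketPow (Ideal.span {x} ⊓ K) p := by
    have := (hstar _ 1 le_rfl).trans (bp_mono h1 (p ^ 1))
    rw [pow_one, Ideal.span_singleton_le_iff_mem] at this
    exact this
  have h3 : bracketPow (Ideal.span {x} ⊓ K) p ≤
      Ideal.span {x ^ p} * IsLocalRing.maximalIdeal R := by
    refine Ideal.span_le.2 ?_
    rintro _ ⟨y, ⟨hy1, hy2⟩, rfl⟩
    obtain ⟨r, rfl⟩ := Ideal.mem_span_singleton'.1 hy1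
    show (r * x) ^ p ∈ _
    rw [mul_pow, mul_comm (r ^ p)]
    refine Ideal.mul_mem_mul (Ideal.mem_span_singleton_self _) ?_
    refine Ideal.pow_mem_of_mem _ ?_ _ hp
    rw [IsLocalRing.mem_maximalIdeal, mem_nonunits_iff]
    intro hu
    exact hxK ((Ideal.unit_mul_mem_iff_mem K hu).1 hy2)
  obtain ⟨t, ht, h4⟩ := Ideal.mem_span_singleton_mul.1 (h3 h2)
  have h5 : IsUnit (1 - t) := by
    by_contra hn
    exact (Ideal.ne_top_iff_one _).1 (IsLocalRing.maximalIdeal.isMaximal R).ne_top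
      (by simpa using add_mem ((IsLocalRing.mem_maximalIdeal _).2 hn) ht)
  have h6 : x ^ p = 0 := by
    refine (h5.mul_left_eq_zero).1 ?_
    linear_combination -h4
  exact hxK (by rw [eq_zero_of_pow_eq_zero h6]; exact zero_mem _)

theorem isDomain_of_regular_aux (d : ℕ) : ∀ (R : Type u) [CommRing R] [IsNoetherianRing R]
    [IsLocalRing R] (f : Fin d → R)
    (_ : IsLocalRing.maximalIdeal R = Ideal.span (Set.range f))
    (_ : (d : WithBot ℕ∞) ≤ ringKrullDim R), IsDomain R := by
  induction d with
  | zero =>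
    intro R _ _ _ f hf _
    have : IsField R := by
      rw [IsLocalRing.isField_iff_maximalIdeal_eq, hf]
      simp
    exact this.isDomain
  | succ d ih =>
    intro R _ _ _ f hf hd
    set x := f 0 with hx
    have hxm : x ∈ IsLocalRing.maximalIdeal R := by
      rw [hf]; exact Ideal.subset_span ⟨0, rfl⟩
    -- dimension drop by at most one
    have drop : ∀ (A : Type u) [CommRing A] [IsNoetherianRing A] [IsLocalRing A] (y : A),
        y ∈ IsLocalRing.maximalIdeal A → ((d + 1 : ℕ) : WithBot ℕ∞) ≤ ringKrullDim A →
        (d : WithBot ℕ∞) ≤ ringKrullDim (A ⧸ Ideal.span {y}) := by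
      intro A _ _ _ y hy hA
      have h := ringKrullDim_le_ringKrullDim_quotient_add_card (R := A) {y} (by
        rw [IsLocalRing.ringJacobson_eq_maximalIdeal]
        simpa using hy)
      have h2 := hA.trans h
      rw [Finset.coe_singleton, Finset.card_singleton] at h2
      push_cast at h2
      exact (ENat.WithBot.add_le_add_one_right_iff).1 h2
    have : Nontrivial (R ⧸ Ideal.span {x}) := by
      rw [Ideal.Quotient.nontrivial_iff]
      intro h
      have h2 := (Ideal.span_singleton_le_iff_mem _).2 hxm
      rw [h, top_le_iff] at h2
      exact (IsLocalRing.maximalIdeal.isMaximal R).ne_top h2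
    let S := R ⧸ Ideal.span {x}
    let π : R →+* S := Ideal.Quotient.mk _
    have hπ : Function.Surjective π := Ideal.Quotient.mk_surjective
    haveI : IsLocalRing S := IsLocalRing.of_surjective' π hπ
    have hmS : IsLocalRing.maximalIdeal S = Ideal.span (Set.range fun i : Fin d => π (f i.succ)) := by
      have h1 : (IsLocalRing.maximalIdeal R).map π = IsLocalRing.maximalIdeal S :=
        IsLocalRing.map_maximalIdeal_of_surjective π hπ
      rw [← h1, hf, Ideal.map_span]
      apply le_antisymm
      · refine Ideal.span_le.2 ?_
        rintro _ ⟨_, ⟨i, rfl⟩, rfl⟩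
        refine Fin.cases ?_ (fun j => ?_) i
        · have : π (f 0) = 0 :=
            Ideal.Quotient.eq_zero_iff_mem.2 (Ideal.mem_span_singleton_self _)
          rw [this]
          exact zero_mem _
        · exact Ideal.subset_span ⟨j, rfl⟩
      · refine Ideal.span_mono ?_
        rintro _ ⟨j, rfl⟩
        exact ⟨_, ⟨j.succ, rfl⟩, rfl⟩
    have hdomS : IsDomain S := ih S _ hmS (drop R x hxm hd)
    have hSd : ringKrullDim S ≤ d := by
      refine (ringKrullDim_le_spanFinrank_maximalIdeal S).trans ?_
      rw [hmS]
      have h1 := Submodule.spanFinrank_span_le_ncard_of_finite (R := S)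
        (Set.finite_range fun i : Fin d => π (f i.succ))
      have h2 : (Set.range fun i : Fin d => π (f i.succ)).ncard ≤ d := by
        rw [← Set.image_univ]
        refine (Set.ncard_image_le Set.finite_univ).trans ?_
        simp
      exact_mod_cast h1.trans h2
    obtain ⟨q, hq, hqd⟩ : ∃ q : Ideal R, q.IsPrime ∧
        ((d + 1 : ℕ) : WithBot ℕ∞) ≤ ringKrullDim (R ⧸ q) := by
      obtain ⟨l, hl⟩ := (Order.le_krullDim_iff (n := d + 1)).1 hd
      refine ⟨l.head.asIdeal, l.head.isPrime, ?_⟩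
      rw [ringKrullDim_quotient]
      refine Order.le_krullDim_iff.2 ⟨⟨l.length, fun i => ⟨l i, ?_⟩, fun i => l.step i⟩, hl⟩
      exact l.head_le i
    have hxq : x ∉ q := by
      intro hxq
      have := ringKrullDim_le_of_surjective (Ideal.Quotient.factor
        ((Ideal.span_singleton_le_iff_mem q).2 hxq)) (Ideal.Quotient.factor_surjective _)
      have := (hqd.trans this).trans hSd
      have h3 : d + 1 ≤ d := by exact_mod_cast this
      omega
    have hqx : q ≤ Ideal.span {x} := by
      intro y hyq
      by_contra hy
      have : Nontrivial (R ⧸ q) := Ideal.Quotient.nontrivial_iff.2 hq.ne_top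
      have : IsLocalRing (R ⧸ q) :=
        IsLocalRing.of_surjective' (Ideal.Quotient.mk q) Ideal.Quotient.mk_surjective
      have h1 := drop (R ⧸ q) (Ideal.Quotient.mk q x) (by
        rw [← IsLocalRing.map_maximalIdeal_of_surjective (Ideal.Quotient.mk q)
          Ideal.Quotient.mk_surjective]
        exact Ideal.mem_map_of_mem _ hxm) hqd
      let g : R →+* (R ⧸ q) ⧸ Ideal.span {Ideal.Quotient.mk q x} :=
        (Ideal.Quotient.mk _).comp (Ideal.Quotient.mk q)
      have hg : Function.Surjective g :=
        Ideal.Quotient.mk_surjective.comp Ideal.Quotient.mk_surjective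
      have hgx : ∀ z ∈ Ideal.span {x}, g z = 0 := by
        intro z hz
        obtain ⟨r, rfl⟩ := Ideal.mem_span_singleton'.1 hz
        have : g x = 0 := Ideal.Quotient.eq_zero_iff_mem.2 (Ideal.mem_span_singleton_self _)
        rw [map_mul, this, mul_zero]
      have hgy : g y = 0 := by
        have : Ideal.Quotient.mk q y = 0 := Ideal.Quotient.eq_zero_iff_mem.2 hyq
        simp [g, this]
      have h2 := ringKrullDim_succ_le_of_surjective (Ideal.Quotient.lift (Ideal.span {x}) g hgx)
        (Ideal.Quotient.lift_surjective_of_surjective _ _ hg) (r := π y)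
        (mem_nonZeroDivisors_of_ne_zero (fun h => hy (Ideal.Quotient.eq_zero_iff_mem.1 h)))
        hgy
      have h3 : ((d : WithBot ℕ∞) + 1) ≤ d := (add_le_add_left h1 1).trans (h2.trans hSd)
      have h4 : d + 1 ≤ d := by exact_mod_cast h3
      omega
    have hq0 : q = ⊥ := by
      refine Submodule.eq_bot_of_le_smul_of_le_jacobson_bot (Ideal.span {x}) q
        (IsNoetherian.noetherian q) ?_ ?_
      · intro y hy
        obtain ⟨r, rfl⟩ := Ideal.mem_span_singleton'.1 (hqx hy)
        have := (hq.mem_or_mem hy).resolve_right hxq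
        rw [mul_comm]
        exact Ideal.mul_mem_mul (Ideal.mem_span_singleton_self _) this
      · rw [Ideal.span_singleton_le_iff_mem]
        exact IsLocalRing.maximalIdeal_le_jacobson _ hxm
    subst hq0
    exact (IsDomain.of_bot_isPrime R)

theorem isDomain_of_regularStmt {R : Type*} [CommRing R] [IsNoetherianRing R] [IsLocalRing R]
    (h : IsRegularStmt R) : IsDomain R := by
  obtain ⟨s, hs, hd⟩ := h
  refine isDomain_of_regular_aux s.card R (fun i => (s.equivFin.symm i : R)) ?_ hd.le
  rw [hs]
  congr 1
  ext y
  constructor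
  · intro hy
    exact ⟨s.equivFin ⟨y, hy⟩, by simp⟩
  · rintro ⟨i, rfl⟩
    exact (s.equivFin.symm i).2

theorem stmt14 {R : Type*} [CommRing R] [IsNoetherianRing R] [IsLocalRing R]
    (p : ℕ) (hp : p.Prime) [CharP R p]
    (hreg : IsRegularStmt R) (hstar : CondStar R p) (a : Ideal R)
    (c : ℝ) (hc : 0 ≤ c) :
    Ie p (tau p a ((p : ℝ) * c)) 1 = tau p a c := by
  haveI : Fact p.Prime := ⟨hp⟩
  haveI := isDomain_of_regularStmt hreg
  have hn : ∀ e : ℕ, (p : ℝ) * c * (p : ℝ) ^ e = c * (p : ℝ) ^ (e + 1) := by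
    intro e; ring
  have key : Ie p (a ^ ⌈c * (p : ℝ) ^ 1⌉₊) 1 ≤ Ie p (a ^ ⌈c * (p : ℝ) ^ 2⌉₊) 2 := by
    refine sInf_le ?_
    intro y hy
    rw [pow_one]
    refine mem_of_pow_mem hstar hp.pos _ y ?_
    have h1 : y ^ p ∈ a ^ ⌈c * (p : ℝ) ^ 2⌉₊ := by
      have h2 : y ^ p ∈ a ^ (⌈c * (p : ℝ) ^ 1⌉₊ * p) := by
        rw [pow_mul]
        exact Ideal.pow_mem_pow hy p
      refine Ideal.pow_le_pow_right ?_ h2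
      rw [Nat.ceil_le]
      push_cast
      have := Nat.le_ceil (c * (p : ℝ) ^ 1)
      calc c * (p : ℝ) ^ 2 = (c * (p : ℝ) ^ 1) * p := by ring
        _ ≤ _ := by gcongr
    have h3 := hstar _ 2 (by norm_num) h1
    have h4 := bp_bp p (Ie p (a ^ ⌈c * (p : ℝ) ^ 2⌉₊) 2) 1
    rw [pow_one] at h4
    rw [h4]
    exact h3
  apply eq_of_forall_ge_iff
  intro J
  rw [Ie_le_iff hstar _ _ le_rfl]
  unfold tau
  rw [iSup_le_iff, iSup_le_iff]
  have hstep : ∀ e : ℕ, 1 ≤ e →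
      (Ie p (a ^ ⌈(p : ℝ) * c * (p : ℝ) ^ e⌉₊) e ≤ bracketPow J (p ^ 1) ↔
        Ie p (a ^ ⌈c * (p : ℝ) ^ (e + 1)⌉₊) (e + 1) ≤ J) := by
    intro e he
    rw [← Ie_le_iff hstar _ _ le_rfl, Ie_Ie hstar _ he, hn]
  constructor
  · rintro h ⟨e, he⟩
    rcases Nat.lt_or_ge 1 e with h1 | h1
    · obtain ⟨k, rfl⟩ : ∃ k, e = k + 1 := ⟨e - 1, by omega⟩
      exact (hstep k (by omega)).1 (h ⟨k, by omega⟩)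
    · obtain rfl : e = 1 := by omega
      exact key.trans ((hstep 1 le_rfl).1 (h ⟨1, le_rfl⟩))
  · rintro h ⟨e, he⟩
    exact (hstep e he).2 (h ⟨e + 1, by omega⟩)
end

section
/- Let R be a Noetherian regular local ring of prime characteristic p > 0 satisfying condition (*), let a be an ideal of R, let c be a non-negative real number, and let e ≥ 1 be an integer. Then I_e(a^{⌈c p^e⌉}) ⊆ I_{e+1}(a^{⌈c p^{e+1}⌉}). -/
universe uu

/-- A regular local ring is a domain. -/
theorem aux_domain (n : ℕ) : ∀ (R : Type uu) [CommRing R] [IsNoetherianRing R] [IsLocalRing R]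
    (s : Finset R), IsLocalRing.maximalIdeal R = Ideal.span (s : Set R) → s.card ≤ n →
    (n : WithBot ℕ∞) ≤ ringKrullDim R → IsDomain R := by
  classical
  induction n with
  | zero =>
    intro R _ _ _ s hs hc _
    have h0 : s = ∅ := by simpa using hc
    have : IsLocalRing.maximalIdeal R = ⊥ := by simp [hs, h0]
    exact (IsLocalRing.isField_iff_maximalIdeal_eq.mpr this).isDomain
  | succ n ih =>
    intro R _ _ _ s hs hc hd
    by_cases hm0 : IsLocalRing.maximalIdeal R = ⊥
    · exact (IsLocalRing.isField_iff_maximalIdeal_eq.mpr hm0).isDomain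
    have hjac : IsLocalRing.maximalIdeal R ≤ Ideal.jacobson ⊥ :=
      (IsLocalRing.jacobson_eq_maximalIdeal ⊥ bot_ne_top).ge
    have hx : ∃ x ∈ IsLocalRing.maximalIdeal R,
        x ∉ IsLocalRing.maximalIdeal R * IsLocalRing.maximalIdeal R ∧
        ∀ P ∈ minimalPrimes R, x ∉ P := by
      by_contra! hcon
      have hsub : ((IsLocalRing.maximalIdeal R : Ideal R) : Set R) ⊆
          ⋃ i ∈ insert (IsLocalRing.maximalIdeal R * IsLocalRing.maximalIdeal R)
            (minimalPrimes R), ((id i : Ideal R) : Set R) := by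
        intro x hx
        by_cases h2 : x ∈ IsLocalRing.maximalIdeal R * IsLocalRing.maximalIdeal R
        · exact Set.mem_biUnion (Set.mem_insert _ _) h2
        · obtain ⟨P, hP, hxP⟩ := hcon x hx h2
          exact Set.mem_biUnion (Set.mem_insert_of_mem _ hP) hxP
      rw [Ideal.subset_union_prime_finite
        ((minimalPrimes.finite_of_isNoetherianRing R).insert _)
        (IsLocalRing.maximalIdeal R * IsLocalRing.maximalIdeal R)
        (IsLocalRing.maximalIdeal R * IsLocalRing.maximalIdeal R)] at hsub
      · obtain ⟨i, hi, hle⟩ := hsub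
        rcases hi with rfl | hi
        · exact hm0 (Submodule.eq_bot_of_le_smul_of_le_jacobson_bot _ _
            (IsNoetherian.noetherian _) hle hjac)
        · have hip : i.IsPrime := hi.1.1
          have heq : IsLocalRing.maximalIdeal R = i :=
            le_antisymm hle (IsLocalRing.le_maximalIdeal hip.ne_top)
          rw [← heq] at hi
          have hh := Ideal.height_eq_zero_iff.mpr hi
          rw [← IsLocalRing.maximalIdeal_height_eq_ringKrullDim, hh] at hd
          norm_cast at hd
      · intro i hi h1 _
        rcases hi with rfl | hi
        · exact absurd rfl h1
        · exact hi.1.1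
    obtain ⟨x, hxm, hx2, hxP⟩ := hx
    have hxs := hxm
    rw [hs] at hxs
    obtain ⟨f, -, hf⟩ := Submodule.mem_span_finset.mp hxs
    have hsm : ∀ b ∈ s, b ∈ IsLocalRing.maximalIdeal R := fun b hb => by
      rw [hs]; exact Ideal.subset_span hb
    obtain ⟨b, hb, hfb⟩ : ∃ b ∈ s, f b ∉ IsLocalRing.maximalIdeal R := by
      by_contra! hcon
      apply hx2
      rw [← hf]
      exact Ideal.sum_mem _ fun b hb => Ideal.mul_mem_mul (hcon b hb) (hsm b hb)
    have hub : IsUnit (f b) := by simpa using hfb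
    have hI : Ideal.span {x} ≤ IsLocalRing.maximalIdeal R := by
      simpa [Ideal.span_le] using hxm
    have hne : Ideal.span {x} ≠ ⊤ := fun h =>
      (IsLocalRing.maximalIdeal.isMaximal R).ne_top (top_le_iff.mp (h ▸ hI))
    have : Nontrivial (R ⧸ Ideal.span {x}) := Ideal.Quotient.nontrivial_iff.mpr hne
    have hsurj := Ideal.Quotient.mk_surjective (I := Ideal.span {x})
    have : IsLocalRing (R ⧸ Ideal.span {x}) := IsLocalRing.of_surjective' _ hsurj
    have hmax : IsLocalRing.maximalIdeal (R ⧸ Ideal.span {x}) =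
        Ideal.span (((s.erase b).image (Ideal.Quotient.mk (Ideal.span {x})) : Finset _) :
          Set (R ⧸ Ideal.span {x})) := by
      rw [← IsLocalRing.map_maximalIdeal_of_surjective _ hsurj]
      apply le_antisymm
      · rw [hs, Ideal.map_span, Ideal.span_le]
        rintro _ ⟨t, ht, rfl⟩
        have hmem : ∀ t ∈ s, t ≠ b → Ideal.Quotient.mk (Ideal.span {x}) t ∈
            Ideal.span (((s.erase b).image (Ideal.Quotient.mk (Ideal.span {x})) : Finset _) :
              Set (R ⧸ Ideal.span {x})) := fun t ht htb =>
          Ideal.subset_span (Finset.mem_coe.mpr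
            (Finset.mem_image_of_mem _ (Finset.mem_erase.mpr ⟨htb, ht⟩)))
        by_cases htb : t = b
        · subst htb
          have h1 : Ideal.Quotient.mk (Ideal.span {x}) x = 0 :=
            Ideal.Quotient.eq_zero_iff_mem.mpr (Ideal.mem_span_singleton_self x)
          have hfx := congrArg (Ideal.Quotient.mk (Ideal.span {x})) hf
          rw [h1, ← Finset.add_sum_erase _ _ hb, map_add, smul_eq_mul, map_mul] at hfx
          have h2 := eq_neg_of_add_eq_zero_left hfx
          refine (Ideal.unit_mul_mem_iff_mem _ (hub.map (Ideal.Quotient.mk (Ideal.span {x})))).mp ?_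
          rw [h2, map_sum]
          refine neg_mem (Ideal.sum_mem _ fun c hc => ?_)
          rw [smul_eq_mul, map_mul]
          exact Ideal.mul_mem_left _ _ (hmem c (Finset.mem_of_mem_erase hc)
            (Finset.ne_of_mem_erase hc))
        · exact hmem t ht htb
      · rw [Ideal.span_le]
        intro y hy
        obtain ⟨t, ht, rfl⟩ := Finset.mem_image.mp (Finset.mem_coe.mp hy)
        exact Ideal.mem_map_of_mem _ (hsm t (Finset.mem_of_mem_erase ht))
    have hcard : ((s.erase b).image (Ideal.Quotient.mk (Ideal.span {x}))).card ≤ n := by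
      refine Finset.card_image_le.trans ?_
      rw [Finset.card_erase_of_mem hb]
      omega
    have hdim : (n : WithBot ℕ∞) ≤ ringKrullDim (R ⧸ Ideal.span {x}) := by
      have h1 := Ideal.height_le_ringKrullDim_quotient_add_one hxm
      rw [IsLocalRing.maximalIdeal_height_eq_ringKrullDim] at h1
      have h2 := hd.trans h1
      push_cast at h2
      generalize ringKrullDim (R ⧸ Ideal.span {x}) = d at h2
      induction d with
      | bot =>
        rw [WithBot.bot_add] at h2
        exact absurd (le_bot_iff.mp h2) (by norm_cast)
      | coe d =>
        norm_cast at h2 ⊢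
        exact (ENat.add_le_add_iff_right ENat.one_ne_top).mp (by exact_mod_cast h2)
    have hdom := ih (R ⧸ Ideal.span {x}) _ hmax hcard hdim
    have hprime : (Ideal.span {x}).IsPrime := (Ideal.Quotient.isDomain_iff_prime _).mp hdom
    obtain ⟨P, hP, hPx⟩ := Ideal.exists_minimalPrimes_le (I := ⊥) (J := Ideal.span {x}) bot_le
    have hPp : P.IsPrime := hP.1.1
    have hP0 : P = ⊥ := by
      refine Submodule.eq_bot_of_le_smul_of_le_jacobson_bot (IsLocalRing.maximalIdeal R) _
            (IsNoetherian.noetherian _) ?_ hjac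
      intro y hy
      obtain ⟨z, rfl⟩ := Ideal.mem_span_singleton.mp (hPx hy)
      exact Ideal.mul_mem_mul hxm ((hPp.mem_or_mem hy).resolve_left (hxP P hP))
    subst hP0
    exact IsDomain.of_bot_isPrime R

theorem aux_key {R : Type*} [CommRing R] [IsLocalRing R] [IsDomain R]
    (p : ℕ) (hp : p.Prime) (hstar : CondStar R p) (u : R) (C : Ideal R)
    (hu : u ^ p ∈ bracketPow C p) : u ∈ C := by
  have hKC : Ie p (Ideal.span {u ^ p}) 1 ≤ C := sInf_le (by
    simpa [Ideal.span_le] using hu)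
  have hKu : Ie p (Ideal.span {u ^ p}) 1 ≤ Ideal.span {u} := sInf_le (by
    simp only [Set.mem_ofPred_eq, pow_one, Ideal.span_le, Set.singleton_subset_iff]
    exact Ideal.subset_span ⟨u, Ideal.mem_span_singleton_self u, rfl⟩)
  have hK := hstar (Ideal.span {u ^ p}) 1 le_rfl
  generalize Ie p (Ideal.span {u ^ p}) 1 = K at *
  by_contra hcon
  have huK : u ∉ K := fun h => hcon (hKC h)
  have hle : bracketPow K (p ^ 1) ≤ Ideal.span {u ^ p} * IsLocalRing.maximalIdeal R := by
    rw [pow_one, bracketPow, Ideal.span_le]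
    rintro _ ⟨k, hk, rfl⟩
    obtain ⟨t, rfl⟩ := Ideal.mem_span_singleton.mp (hKu hk)
    have ht : t ∈ IsLocalRing.maximalIdeal R := by
      intro htu
      exact huK ((Ideal.mul_unit_mem_iff_mem K htu).mp hk)
    simp only [mul_pow]
    exact Ideal.mul_mem_mul (Ideal.mem_span_singleton_self _)
      (Ideal.pow_mem_of_mem _ ht p hp.pos)
  have h1 := hle (hK (Ideal.mem_span_singleton_self _))
  obtain ⟨z, hz, hzu⟩ := Ideal.mem_span_singleton_mul.mp h1
  have h0 : u ^ p = 0 := by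
    by_contra hne
    have : z = 1 := mul_left_cancel₀ hne (by rw [hzu, mul_one])
    subst this
    exact (Ideal.ne_top_iff_one _).mp (IsLocalRing.maximalIdeal.isMaximal R).ne_top hz
  exact hcon ((pow_eq_zero_iff hp.ne_zero).mp h0 ▸ C.zero_mem)

/-- The chain `I_e(a^{⌈c p^e⌉})` is ascending in `e`. -/
theorem stmt15 {R : Type*} [CommRing R] [IsNoetherianRing R] [IsLocalRing R]
    (p : ℕ) (hp : p.Prime) [CharP R p]
    (hreg : IsRegularStmt R) (hstar : CondStar R p) (a : Ideal R)
    (c : ℝ) (hc : 0 ≤ c) (e : ℕ) (he : 1 ≤ e) :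
    Ie p (a ^ ⌈c * (p : ℝ) ^ e⌉₊) e ≤ Ie p (a ^ ⌈c * (p : ℝ) ^ (e + 1)⌉₊) (e + 1) := by
  obtain ⟨s, hs, hcard⟩ := hreg
  have : IsDomain R := aux_domain s.card R s hs le_rfl hcard.le
  have hN : ⌈c * (p : ℝ) ^ (e + 1)⌉₊ ≤ ⌈c * (p : ℝ) ^ e⌉₊ * p := by
    rw [Nat.ceil_le]
    push_cast
    rw [pow_succ, ← mul_assoc]
    exact mul_le_mul_of_nonneg_right (Nat.le_ceil _) (Nat.cast_nonneg p)
  have h := hstar (a ^ ⌈c * (p : ℝ) ^ (e + 1)⌉₊) (e + 1) (by omega)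
  refine sInf_le ?_
  intro u hu
  refine aux_key p hp hstar u _ ?_
  have h1 : u ^ p ∈ a ^ ⌈c * (p : ℝ) ^ (e + 1)⌉₊ :=
    Ideal.pow_le_pow_right hN (by rw [pow_mul]; exact Ideal.pow_mem_pow hu p)
  refine (Ideal.span_le.mpr ?_ : bracketPow _ (p ^ (e + 1)) ≤ _) (h h1)
  rintro _ ⟨x, hx, rfl⟩
  refine Ideal.subset_span ⟨x ^ p ^ e, Ideal.subset_span ⟨x, hx, rfl⟩, ?_⟩
  simp only [← pow_mul, pow_succ]
end
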